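/- arXiv:1612.01123 — 3 statements merged into one kernel-verified Lean document; each statement's English description precedes it below -/
import Mathlib

section
/- Let I = [a,b] ⊂ (0,∞) be a compact interval and W : ℝ → ℝ a smooth, nonnegative function with support contained in [0,1]. Then there exists a constant C > 0, depending only on I and W, such that the following holds: for every N > 0, every continuous V : [0,∞) → ℝ with V(x) = 0 for all x ≥ N, every ξ ∈ I, every λ ∈ ℝ with |λ| ≤ 1 and C·|λ| ≤ 1/2, and every pair of twice continuously differentiable functions u, v : [0,∞) → ℝ satisfying −u''(x) + V(x)·u(x) = ξ·u(x) and −v''(x) + (V(x) + λ·W(x − N))·v(x) = ξ·v(x) with u(0) = v(0) = 1 and u'(0) = v'(0) = 0, one has, for all x ≥ 0, (1/2)·‖(u(x), u'(x))‖ ≤ ‖(v(x), v'(x))‖ ≤ (3/2)·‖(u(x), u'(x))‖, where ‖·‖ is the Euclidean norm on ℝ². -/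
open Set in
/-- Grönwall's inequality for an affine differential inequality. -/
theorem add_le_exp_mul_of_deriv_le {f f' : ℝ → ℝ} {K c p q : ℝ}
    (hf : ContinuousOn f (Icc p q)) (hf' : ∀ x ∈ Ioo p q, HasDerivAt f (f' x) x)
    (bound : ∀ x ∈ Ioo p q, f' x ≤ K * (f x + c)) {x : ℝ} (hx : x ∈ Icc p q) :
    f x + c ≤ Real.exp (K * (x - p)) * (f p + c) := by
  have hanti : AntitoneOn (fun y => Real.exp (-(K * (y - p))) * (f y + c)) (Icc p q) := by
    refine antitoneOn_of_hasDerivWithinAt_nonpos (convex_Icc p q)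
      (f' := fun y => Real.exp (-(K * (y - p))) * (f' y - K * (f y + c))) ?_ ?_ ?_
    · exact (by fun_prop : Continuous fun y => Real.exp (-(K * (y - p)))).continuousOn.mul
        (hf.add continuousOn_const)
    · intro y hy
      rw [interior_Icc] at hy
      have hlin : HasDerivAt (fun y => -(K * (y - p))) (-(K * 1)) y :=
        (((hasDerivAt_id y).sub_const p).const_mul K).neg
      exact ((hlin.exp.mul ((hf' y hy).add_const c)).congr_deriv (by ring)).hasDerivWithinAt
    · intro y hy
      rw [interior_Icc] at hy
      exact mul_nonpos_of_nonneg_of_nonpos (Real.exp_pos _).le (sub_nonpos.2 (bound y hy))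
  have h := hanti (left_mem_Icc.2 (hx.1.trans hx.2)) hx hx.1
  simp only [sub_self, mul_zero, neg_zero, Real.exp_zero, one_mul] at h
  calc f x + c
      = Real.exp (K * (x - p)) * (Real.exp (-(K * (x - p))) * (f x + c)) := by
        rw [← mul_assoc, ← Real.exp_add, add_neg_cancel, Real.exp_zero, one_mul]
    _ ≤ _ := mul_le_mul_of_nonneg_left h (Real.exp_pos _).le

/-- The derivative of the energy `ξ f² + f'²` along `f'' = g`. -/
theorem hasDerivAt_energy {f f' : ℝ → ℝ} {g x : ℝ} (ξ : ℝ) (hf : HasDerivAt f (f' x) x)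
    (hf' : HasDerivAt f' g x) :
    HasDerivAt (fun y => ξ * f y ^ 2 + f' y ^ 2) (2 * f' x * (ξ * f x + g)) x :=
  (((hf.pow 2).const_mul ξ).add (hf'.pow 2)).congr_deriv (by push_cast; ring)

/-- The energy of a solution of `f'' = -ξ f` is conserved. -/
theorem energy_eq_of_free {f f' : ℝ → ℝ} {ξ p x : ℝ} (hfc : ContinuousOn f (Set.Ici p))
    (hfc' : ContinuousOn f' (Set.Ici p)) (hf : ∀ y, p < y → HasDerivAt f (f' y) y)
    (hf' : ∀ y, p < y → HasDerivAt f' (-(ξ * f y)) y) (hx : p ≤ x) :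
    ξ * f x ^ 2 + f' x ^ 2 = ξ * f p ^ 2 + f' p ^ 2 := by
  have hcont : ContinuousOn (fun y => ξ * f y ^ 2 + f' y ^ 2) (Set.Icc p x) :=
    ((continuousOn_const.mul (hfc.pow 2)).add (hfc'.pow 2)).mono fun z hz => hz.1
  have hder {z : ℝ} (hz : p < z) : HasDerivAt (fun y => ξ * f y ^ 2 + f' y ^ 2) 0 z :=
    (hasDerivAt_energy ξ (hf z hz) (hf' z hz)).congr_deriv (by ring)
  have h1 := add_le_exp_mul_of_deriv_le (K := 0) (c := 0) hcont (fun z hz => hder hz.1)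
    (fun z hz => by simp) (Set.right_mem_Icc.2 hx)
  have h2 := add_le_exp_mul_of_deriv_le (K := 0) (c := 0) hcont.neg
    (fun z hz => (hder hz.1).neg) (fun z hz => by simp) (Set.right_mem_Icc.2 hx)
  simp only [zero_mul, Real.exp_zero, one_mul, add_zero, Pi.neg_apply] at h1 h2
  linarith

theorem sqrt_comparison_of_sq_dist_le {p q r s : ℝ}
    (h : (r - p) ^ 2 + (s - q) ^ 2 ≤ 1 / 4 * (p ^ 2 + q ^ 2)) :
    1 / 2 * √(p ^ 2 + q ^ 2) ≤ √(r ^ 2 + s ^ 2) ∧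
      √(r ^ 2 + s ^ 2) ≤ 3 / 2 * √(p ^ 2 + q ^ 2) := by
  have hA : 0 ≤ p ^ 2 + q ^ 2 := by positivity
  constructor
  · apply Real.le_sqrt_of_sq_le
    rw [mul_pow, Real.sq_sqrt hA]
    nlinarith [sq_nonneg (p + 2 * (r - p)), sq_nonneg (q + 2 * (s - q))]
  · apply Real.sqrt_le_iff.2 ⟨by positivity, ?_⟩
    rw [mul_pow, Real.sq_sqrt hA]
    nlinarith [sq_nonneg (p - 2 * (r - p)), sq_nonneg (q - 2 * (s - q))]

theorem exists_bound_of_support_subset_Icc {W : ℝ → ℝ} (hW : Continuous W)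
    (hsupp : Function.support W ⊆ Set.Icc 0 1) : ∃ M, ∀ x, |W x| ≤ M := by
  obtain ⟨M, hM⟩ := isCompact_Icc.exists_bound_of_continuousOn (s := Set.Icc (0 : ℝ) 1)
    hW.continuousOn
  refine ⟨M, fun x => ?_⟩
  by_cases hx : x ∈ Set.Icc (0 : ℝ) 1
  · exact hM x hx
  · rw [Function.notMem_support.1 fun h => hx (hsupp h), abs_zero]
    exact (norm_nonneg _).trans (hM 0 (by simp))

/-- The right-hand side of the energy inequality for the difference of the two solutions. -/
theorem energy_rate_le {a ξ lam M t w w' u : ℝ} (ha : 0 < a) (hξ : a ≤ ξ) (hlam : |lam| ≤ 1)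
    (ht : |t| ≤ M) :
    -(2 * lam * t * w' * (w + u)) ≤
      M * (2 + 1 / a) * (ξ * w ^ 2 + w' ^ 2 + lam ^ 2 * (ξ * u ^ 2)) := by
  have hM : 0 ≤ M := (abs_nonneg t).trans ht
  have key (y : ℝ) : y ^ 2 ≤ 1 / a * (ξ * y ^ 2) := by
    rw [one_div, ← div_eq_inv_mul, le_div_iff₀ ha]
    nlinarith [sq_nonneg y]
  have h1 : 2 * |lam| * |w'| * |w| ≤ w' ^ 2 + w ^ 2 := by
    have := two_mul_le_add_sq |w'| |w|
    rw [sq_abs, sq_abs] at this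
    nlinarith [mul_nonneg (abs_nonneg w') (abs_nonneg w)]
  have h2 : 2 * |lam| * |w'| * |u| ≤ w' ^ 2 + lam ^ 2 * u ^ 2 := by
    have := two_mul_le_add_sq |w'| (|lam| * |u|)
    rw [mul_pow, sq_abs, sq_abs, sq_abs] at this
    linarith
  have h3 : 2 * |lam| * |w'| * |w + u| ≤
      (2 + 1 / a) * (ξ * w ^ 2 + w' ^ 2 + lam ^ 2 * (ξ * u ^ 2)) := by
    have h4 : 2 * |lam| * |w'| * |w + u| ≤ 2 * |lam| * |w'| * (|w| + |u|) := by
      gcongr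
      exact abs_add_le w u
    have h5 : 0 < 1 / a := by positivity
    have h6 : 0 ≤ ξ := ha.le.trans hξ
    have h7 := mul_le_mul_of_nonneg_left (key u) (sq_nonneg lam)
    have h8 : 0 ≤ 1 / a * w' ^ 2 := by positivity
    have h9 : 0 ≤ ξ * w ^ 2 := by positivity
    have h10 : 0 ≤ lam ^ 2 * (ξ * u ^ 2) := by positivity
    nlinarith [key w]
  calc -(2 * lam * t * w' * (w + u)) ≤ |2 * lam * t * w' * (w + u)| := neg_le_abs _
    _ = |t| * (2 * |lam| * |w'| * |w + u|) := by
      simp only [abs_mul, abs_two]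
      ring
    _ ≤ M * ((2 + 1 / a) * (ξ * w ^ 2 + w' ^ 2 + lam ^ 2 * (ξ * u ^ 2))) := by gcongr
    _ = _ := by ring

/-- Converts an energy bound into a bound for the Euclidean norm. -/
theorem sq_add_sq_le_of_energy_le {a b ξ lam k w w' p p' : ℝ} (ha : 0 < a)
    (hξ : ξ ∈ Set.Icc a b) (hk : 0 ≤ k)
    (h : ξ * w ^ 2 + w' ^ 2 ≤ k * (lam ^ 2 * (ξ * p ^ 2 + p' ^ 2))) :
    w ^ 2 + w' ^ 2 ≤ k * (1 + b) * (1 + 1 / a) * lam ^ 2 * (p ^ 2 + p' ^ 2) := by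
  have hb : 0 < b := ha.trans_le (hξ.1.trans hξ.2)
  have hlow : w ^ 2 + w' ^ 2 ≤ (1 + 1 / a) * (ξ * w ^ 2 + w' ^ 2) := by
    have h1 : 1 ≤ 1 / a * ξ := by
      rw [one_div, ← div_eq_inv_mul]
      exact (one_le_div ha).2 hξ.1
    have h2 : 0 ≤ 1 / a := by positivity
    nlinarith [mul_le_mul_of_nonneg_right h1 (sq_nonneg w), mul_nonneg h2 (sq_nonneg w'),
      mul_nonneg (ha.le.trans hξ.1) (sq_nonneg w)]
  have hupp : ξ * p ^ 2 + p' ^ 2 ≤ (1 + b) * (p ^ 2 + p' ^ 2) := by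
    nlinarith [mul_le_mul_of_nonneg_right hξ.2 (sq_nonneg p), sq_nonneg p,
      mul_nonneg hb.le (sq_nonneg p')]
  calc _ ≤ (1 + 1 / a) * (ξ * w ^ 2 + w' ^ 2) := hlow
    _ ≤ (1 + 1 / a) * (k * (lam ^ 2 * ((1 + b) * (p ^ 2 + p' ^ 2)))) := by
      refine mul_le_mul_of_nonneg_left (h.trans ?_) (by positivity)
      gcongr
    _ = _ := by ring

/-- Lemma 2.8 (two-sided comparison): with `C` the perturbation constant of the interval
`[a,b]` and `W`, if moreover `C·|λ| ≤ 1/2`, then the norms of `(u(x),u'(x))` and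
`(v(x),v'(x))` are comparable within factors `1/2` and `3/2`. -/
theorem sparse_perturbation_solution_comparison (a b : ℝ) (ha : 0 < a) (hab : a ≤ b)
    (W : ℝ → ℝ) (hWsmooth : ContDiff ℝ (⊤ : ℕ∞) W) (hWnonneg : ∀ x, 0 ≤ W x)
    (hWsupp : Function.support W ⊆ Set.Icc 0 1) :
    ∃ C : ℝ, 0 < C ∧ ∀ N : ℝ, 0 < N →
      ∀ V : ℝ → ℝ, ContinuousOn V (Set.Ici 0) → (∀ x, N ≤ x → V x = 0) →
      ∀ ξ ∈ Set.Icc a b, ∀ lam : ℝ, |lam| ≤ 1 → C * |lam| ≤ 1 / 2 →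
      ∀ u u' v v' : ℝ → ℝ,
        (∀ x ∈ Set.Ici (0 : ℝ), HasDerivWithinAt u (u' x) (Set.Ici 0) x) →
        (∀ x ∈ Set.Ici (0 : ℝ),
          HasDerivWithinAt u' ((V x - ξ) * u x) (Set.Ici 0) x) →
        (∀ x ∈ Set.Ici (0 : ℝ), HasDerivWithinAt v (v' x) (Set.Ici 0) x) →
        (∀ x ∈ Set.Ici (0 : ℝ),
          HasDerivWithinAt v' ((V x + lam * W (x - N) - ξ) * v x) (Set.Ici 0) x) →
        u 0 = 1 → v 0 = 1 → u' 0 = 0 → v' 0 = 0 →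
        ∀ x : ℝ, 0 ≤ x →
          (1 / 2) * Real.sqrt ((u x) ^ 2 + (u' x) ^ 2) ≤
              Real.sqrt ((v x) ^ 2 + (v' x) ^ 2) ∧
            Real.sqrt ((v x) ^ 2 + (v' x) ^ 2) ≤
              (3 / 2) * Real.sqrt ((u x) ^ 2 + (u' x) ^ 2) := by
  obtain ⟨M, hM⟩ := exists_bound_of_support_subset_Icc hWsmooth.continuous hWsupp
  set K := M * (2 + 1 / a)
  have hb : 0 < b := ha.trans_le hab
  have hCpos : 0 < Real.exp K * (1 + b) * (1 + 1 / a) := by positivity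
  refine ⟨√(Real.exp K * (1 + b) * (1 + 1 / a)), Real.sqrt_pos.2 hCpos, ?_⟩
  intro N hN V hVcont hV ξ hξ lam hlam hClam u u' v v' hu hu' hv hv' hu0 hv0 hu'0 hv'0 x hx
  apply sqrt_comparison_of_sq_dist_le
  have hξ0 : 0 < ξ := ha.trans_le hξ.1
  have hWout {y : ℝ} (hy : y < 0 ∨ 1 < y) : W y = 0 :=
    Function.notMem_support.1 fun h => by
      have := hWsupp h
      rcases hy with hy | hy
      · exact hy.not_ge this.1
      · exact hy.not_ge this.2
  have huc : ContinuousOn u (Set.Ici 0) := fun y hy => (hu y hy).continuousWithinAt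
  have huc' : ContinuousOn u' (Set.Ici 0) := fun y hy => (hu' y hy).continuousWithinAt
  have hvc : ContinuousOn v (Set.Ici 0) := fun y hy => (hv y hy).continuousWithinAt
  have hvc' : ContinuousOn v' (Set.Ici 0) := fun y hy => (hv' y hy).continuousWithinAt
  have energy_cont (η : ℝ) {p q : ℝ} (hp : 0 ≤ p) :
      ContinuousOn (fun y => η * (v y - u y) ^ 2 + (v' y - u' y) ^ 2) (Set.Icc p q) :=
    ((continuousOn_const.mul ((hvc.sub huc).pow 2)).add ((hvc'.sub huc').pow 2)).mono
      fun y hy => hp.trans hy.1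
  have energy_deriv (η : ℝ) {y : ℝ} (hy : 0 < y) :
      HasDerivAt (fun y => η * (v y - u y) ^ 2 + (v' y - u' y) ^ 2)
        (2 * (v' y - u' y) * (η * (v y - u y) +
          ((V y + lam * W (y - N) - ξ) * v y - (V y - ξ) * u y))) y := by
    have hnhds : Set.Ici (0 : ℝ) ∈ nhds y := Ici_mem_nhds hy
    exact hasDerivAt_energy (f := fun y => v y - u y) (f' := fun y => v' y - u' y) η
      (((hv y hy.le).hasDerivAt hnhds).sub ((hu y hy.le).hasDerivAt hnhds))
      (((hv' y hy.le).hasDerivAt hnhds).sub ((hu' y hy.le).hasDerivAt hnhds))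
  -- the two solutions agree up to `N`
  have hagree : ∀ y ∈ Set.Icc 0 N, v y - u y = 0 ∧ v' y - u' y = 0 := by
    obtain ⟨L, hL⟩ := isCompact_Icc.exists_bound_of_continuousOn (s := Set.Icc 0 N)
      (f := fun y => 1 + V y - ξ)
      (((continuousOn_const.add hVcont).sub continuousOn_const).mono fun y hy => hy.1)
    intro y hy
    have h := add_le_exp_mul_of_deriv_le (K := L) (c := 0) (energy_cont 1 le_rfl)
      (fun y hy => energy_deriv 1 hy.1) (fun z hz => ?_) hy
    · simp only [hu0, hv0, hu'0, hv'0, sub_self] at h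
      constructor <;> nlinarith [sq_nonneg (v y - u y), sq_nonneg (v' y - u' y)]
    · have hz' := hL z ⟨hz.1.le, hz.2.le⟩
      rw [hWout (Or.inl (sub_neg.2 hz.2))]
      have h1 := two_mul_le_add_sq |v z - u z| |v' z - u' z|
      rw [sq_abs, sq_abs] at h1
      calc _ = (1 + V z - ξ) * (2 * (v z - u z) * (v' z - u' z)) := by ring
        _ ≤ |(1 + V z - ξ) * (2 * (v z - u z) * (v' z - u' z))| := le_abs_self _
        _ = |1 + V z - ξ| * (2 * |v z - u z| * |v' z - u' z|) := by
          simp only [abs_mul, abs_two]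
        _ ≤ L * ((v z - u z) ^ 2 + (v' z - u' z) ^ 2) := by
          gcongr
          · exact (norm_nonneg _).trans hz'
          · exact hz'
        _ = _ := by ring
  rcases le_total x N with hxN | hNx
  · obtain ⟨h1, h2⟩ := hagree x ⟨hx, hxN⟩
    rw [h1, h2, zero_pow two_ne_zero, add_zero]
    positivity
  -- past `N` the energy of `u` is conserved
  have hE : ∀ y, N ≤ y → ξ * u y ^ 2 + u' y ^ 2 = ξ * u N ^ 2 + u' N ^ 2 := by
    refine fun y hy => energy_eq_of_free (huc.mono fun z hz => hN.le.trans hz)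
      (huc'.mono fun z hz => hN.le.trans hz) (fun z hz => ?_) (fun z hz => ?_) hy
    · exact (hu z (hN.trans hz).le).hasDerivAt (Ici_mem_nhds (hN.trans hz))
    · exact ((hu' z (hN.trans hz).le).hasDerivAt (Ici_mem_nhds (hN.trans hz))).congr_deriv
        (by rw [hV z hz.le]; ring)
  set E := ξ * u N ^ 2 + u' N ^ 2
  have hE0 : 0 ≤ E := by positivity
  obtain ⟨hwN, hwN'⟩ := hagree N ⟨hN.le, le_rfl⟩
  have hbump : ∀ y ∈ Set.Icc N (N + 1),
      ξ * (v y - u y) ^ 2 + (v' y - u' y) ^ 2 ≤ Real.exp K * (lam ^ 2 * E) := by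
    intro y hy
    have h := add_le_exp_mul_of_deriv_le (K := K) (c := lam ^ 2 * E) (energy_cont ξ hN.le)
      (fun z hz => energy_deriv ξ (hN.trans hz.1)) (fun z hz => ?_) hy
    · simp only [hwN, hwN'] at h
      have hM0 : 0 ≤ M := (abs_nonneg _).trans (hM 0)
      have hexp : Real.exp (K * (y - N)) ≤ Real.exp K := by
        apply Real.exp_le_exp.2
        exact mul_le_of_le_one_right (by positivity) (by linarith [hy.2])
      have hc : 0 ≤ lam ^ 2 * E := by positivity
      nlinarith [mul_le_mul_of_nonneg_right hexp hc]
    · have hK0 : 0 ≤ K := by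
        have : 0 ≤ M := (abs_nonneg _).trans (hM 0)
        positivity
      calc _ = -(2 * lam * -W (z - N) * (v' z - u' z) * ((v z - u z) + u z)) := by
            rw [hV z hz.1.le]
            ring
        _ ≤ K * (ξ * (v z - u z) ^ 2 + (v' z - u' z) ^ 2 + lam ^ 2 * (ξ * u z ^ 2)) :=
            energy_rate_le ha hξ.1 hlam ((abs_neg _).trans_le (hM (z - N)))
        _ ≤ _ := by
            gcongr
            rw [← hE z hz.1.le]
            exact le_add_of_nonneg_right (sq_nonneg _)
  have hall : ξ * (v x - u x) ^ 2 + (v' x - u' x) ^ 2 ≤ Real.exp K * (lam ^ 2 * E) := by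
    rcases le_total x (N + 1) with hx1 | hx1
    · exact hbump x ⟨hNx, hx1⟩
    · have h := add_le_exp_mul_of_deriv_le (K := 0) (c := 0) (energy_cont ξ (by linarith))
        (fun z hz => energy_deriv ξ (by linarith [hz.1])) (fun z hz => ?_)
        (Set.right_mem_Icc.2 hx1)
      · simp only [zero_mul, Real.exp_zero, one_mul, add_zero] at h
        exact h.trans (hbump (N + 1) ⟨by linarith, le_rfl⟩)
      · rw [hV z (by linarith [hz.1]), hWout (Or.inr (by linarith [hz.1]))]
        apply le_of_eq
        ring
  rw [← hE x hNx] at hall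
  have hsq : Real.exp K * (1 + b) * (1 + 1 / a) * lam ^ 2 ≤ 1 / 4 := by
    have h := pow_le_pow_left₀ (by positivity) hClam 2
    rw [mul_pow, Real.sq_sqrt hCpos.le, sq_abs] at h
    linarith
  calc _ ≤ Real.exp K * (1 + b) * (1 + 1 / a) * lam ^ 2 * (u x ^ 2 + u' x ^ 2) :=
        sq_add_sq_le_of_energy_le ha hξ (Real.exp_pos K).le hall
    _ ≤ 1 / 4 * (u x ^ 2 + u' x ^ 2) := mul_le_mul_of_nonneg_right hsq (by positivity)
end

section
/- Let I = [a,b] ⊂ (0,∞) be a compact interval and W : ℝ → ℝ a smooth, nonnegative function with support contained in [0,1]. Then there exists a constant C > 0, depending only on I and W, such that the following holds: for every N > 0, every continuous V : [0,∞) → ℝ with V(x) = 0 for all x ≥ N, every ξ ∈ I, every λ ∈ ℝ with |λ| ≤ 1, and every pair of twice continuously differentiable functions u, v : [0,∞) → ℝ satisfying −u''(x) + V(x)·u(x) = ξ·u(x) and −v''(x) + (V(x) + λ·W(x − N))·v(x) = ξ·v(x) with u(0) = v(0) = 1 and u'(0) = v'(0) = 0, defining the variation-of-parameters coefficients (A₁ᵘ(x),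 A₂ᵘ(x))ᵀ = T⁰ₓ(ξ)⁻¹·(u(x), u'(x))ᵀ and (A₁ᵛ(x), A₂ᵛ(x))ᵀ = T⁰ₓ(ξ)⁻¹·(v(x), v'(x))ᵀ, one has, for all x ≥ 0, ‖(A₁ᵛ(x) − A₁ᵘ(x), A₂ᵛ(x) − A₂ᵘ(x))‖ ≤ C·|λ|·‖(u(x), u'(x))‖, where ‖·‖ is the Euclidean norm on ℝ². -/
/-- The free transfer matrix `T⁰ₓ(ξ)` for the equation `-u'' = ξ u`. -/
noncomputable def freeTransfer (ξ x : ℝ) : Matrix (Fin 2) (Fin 2) ℝ :=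
  !![Real.cos (Real.sqrt ξ * x), Real.sin (Real.sqrt ξ * x) / Real.sqrt ξ;
     -(Real.sqrt ξ * Real.sin (Real.sqrt ξ * x)), Real.cos (Real.sqrt ξ * x)]

theorem freeTransfer_inv {ξ : ℝ} (hξ : 0 < ξ) (x : ℝ) :
    (freeTransfer ξ x)⁻¹ =
      !![Real.cos (√ξ * x), -(Real.sin (√ξ * x) / √ξ);
        √ξ * Real.sin (√ξ * x), Real.cos (√ξ * x)] := by
  have hk : √ξ ≠ 0 := (Real.sqrt_pos.2 hξ).ne'
  have hcs := Real.sin_sq_add_cos_sq (√ξ * x)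
  refine Matrix.inv_eq_left_inv ?_
  ext i j
  fin_cases i <;> fin_cases j <;> simp [freeTransfer, Matrix.mul_apply, Fin.sum_univ_two] <;>
    field_simp <;> linarith

/-- The quadratic form `ξ y² + (y')²` of a solution is preserved by the free evolution. -/
theorem freeTransfer_inv_energy {ξ : ℝ} (hξ : 0 < ξ) (x p p' q q' : ℝ) :
    ξ * ((freeTransfer ξ x)⁻¹.mulVec ![p, p'] 0 - (freeTransfer ξ x)⁻¹.mulVec ![q, q'] 0) ^ 2 +
        ((freeTransfer ξ x)⁻¹.mulVec ![p, p'] 1 - (freeTransfer ξ x)⁻¹.mulVec ![q, q'] 1) ^ 2 =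
      ξ * (p - q) ^ 2 + (p' - q') ^ 2 := by
  have hk : √ξ ≠ 0 := (Real.sqrt_pos.2 hξ).ne'
  have hcs := Real.sin_sq_add_cos_sq (√ξ * x)
  have hk2 : √ξ ^ 2 = ξ := Real.sq_sqrt hξ.le
  rw [freeTransfer_inv hξ]
  simp only [Matrix.mulVec, dotProduct, Fin.sum_univ_two, Matrix.of_apply, Matrix.cons_val_zero,
    Matrix.cons_val_one]
  generalize Real.sin (√ξ * x) = s at *
  generalize Real.cos (√ξ * x) = c at *
  generalize √ξ = k at *
  subst hk2
  field_simp
  linear_combination (k ^ 2 * (p - q) ^ 2 + (p' - q') ^ 2) * hcs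

/-- A Grönwall inequality for a scalar function, with derivatives only in the interior. -/
theorem add_le_mul_exp_of_hasDerivAt_le {f f' : ℝ → ℝ} {p q K B : ℝ} (hpq : p ≤ q)
    (hf : ContinuousOn f (Set.Icc p q)) (hf' : ∀ x ∈ Set.Ioo p q, HasDerivAt f (f' x) x)
    (hle : ∀ x ∈ Set.Ioo p q, f' x ≤ K * (f x + B)) :
    f q + B ≤ (f p + B) * Real.exp (K * (q - p)) := by
  have hd : ∀ x ∈ Set.Ioo p q, HasDerivAt (fun y => (f y + B) * Real.exp (-K * (y - p)))
      ((f' x - K * (f x + B)) * Real.exp (-K * (x - p))) x := fun x hx => by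
    have h1 : HasDerivAt (fun y => Real.exp (-K * (y - p)))
        (Real.exp (-K * (x - p)) * (-K * 1)) x :=
      (((hasDerivAt_id x).sub_const p).const_mul (-K)).exp
    exact (((hf' x hx).add_const B).mul h1).congr_deriv (by ring)
  have hanti : AntitoneOn (fun y => (f y + B) * Real.exp (-K * (y - p))) (Set.Icc p q) := by
    refine antitoneOn_of_deriv_nonpos (convex_Icc p q) (by fun_prop) ?_ ?_ <;>
      rw [interior_Icc]
    · exact fun x hx => (hd x hx).differentiableAt.differentiableWithinAt
    · intro x hx
      rw [(hd x hx).deriv]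
      exact mul_nonpos_of_nonpos_of_nonneg (by linarith [hle x hx]) (Real.exp_pos _).le
  have h := hanti (Set.left_mem_Icc.2 hpq) (Set.right_mem_Icc.2 hpq) hpq
  simp only [sub_self, mul_zero, Real.exp_zero, mul_one] at h
  calc f q + B = (f q + B) * Real.exp (-K * (q - p)) * Real.exp (K * (q - p)) := by
        rw [mul_assoc, ← Real.exp_add]; simp
    _ ≤ _ := by gcongr

/-- The form `ξ y² + (y')²` along a function with second derivative `y''`. -/
theorem hasDerivAt_energy_s16 {y y' : ℝ → ℝ} {y'' ξ x : ℝ} (hy : HasDerivAt y (y' x) x)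
    (hy' : HasDerivAt y' y'' x) :
    HasDerivAt (fun t => ξ * y t ^ 2 + y' t ^ 2) (2 * y' x * (ξ * y x + y'')) x := by
  exact (((hy.pow 2).const_mul ξ).add (hy'.pow 2)).congr_deriv (by push_cast; ring)

/-- Pointwise energy growth of the difference `d` of the perturbed and the free solution, driven
by the solution `u`. -/
theorem perturbation_energy_growth {a ξ w lam W u d d' E₀ : ℝ} (ha : 0 < a) (haξ : a ≤ ξ)
    (hw : |W| ≤ w) (hlam : |lam| ≤ 1) (hu : ξ * u ^ 2 ≤ E₀) :
    2 * d' * (lam * W * (u + d)) ≤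
      (1 + w * (1 + 1 / a)) * (ξ * d ^ 2 + d' ^ 2 + lam ^ 2 * (w ^ 2 / a) * E₀) := by
  have hw0 : 0 ≤ w := (abs_nonneg W).trans hw
  have hξ : 0 < ξ := ha.trans_le haξ
  have hu2 : u ^ 2 ≤ E₀ / a := by
    rw [le_div_iff₀ ha]; nlinarith [sq_nonneg u]
  have hd2 : d ^ 2 ≤ ξ * d ^ 2 / a := by
    rw [le_div_iff₀ ha]; nlinarith [sq_nonneg d]
  have hE : 0 ≤ E₀ := le_trans (by positivity) hu
  have hW2 : W ^ 2 ≤ w ^ 2 := sq_le_sq' (abs_le.1 hw).1 (abs_le.1 hw).2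
  have h1 : 2 * d' * (lam * W * u) ≤ d' ^ 2 + lam ^ 2 * (w ^ 2 / a) * E₀ := by
    have h : (lam * W * u) ^ 2 ≤ lam ^ 2 * (w ^ 2 / a) * E₀ := by
      calc (lam * W * u) ^ 2 = lam ^ 2 * W ^ 2 * u ^ 2 := by ring
        _ ≤ lam ^ 2 * w ^ 2 * (E₀ / a) := by gcongr
        _ = _ := by ring
    nlinarith [sq_nonneg (d' - lam * W * u)]
  have h2 : 2 * d' * (lam * W * d) ≤ w * (d' ^ 2 + d ^ 2) := by
    calc 2 * d' * (lam * W * d) ≤ |2 * d' * (lam * W * d)| := le_abs_self _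
      _ = |lam| * |W| * (2 * |d'| * |d|) := by simp only [abs_mul, abs_two]; ring
      _ ≤ 1 * w * (2 * |d'| * |d|) := by gcongr
      _ ≤ 1 * w * (|d'| ^ 2 + |d| ^ 2) := by gcongr; exact two_mul_le_add_sq _ _
      _ = _ := by simp only [sq_abs, one_mul]
  have h3 : w * (d' ^ 2 + d ^ 2) ≤ w * ((1 + 1 / a) * (ξ * d ^ 2 + d' ^ 2)) := by
    gcongr
    have : 0 ≤ ξ * d ^ 2 := by positivity
    have : 0 ≤ d' ^ 2 / a := by positivity
    calc d' ^ 2 + d ^ 2 ≤ d' ^ 2 + ξ * d ^ 2 / a + ξ * d ^ 2 + d' ^ 2 / a := by linarith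
      _ = _ := by ring
  have h4 : 0 ≤ ξ * d ^ 2 := by positivity
  have h5 : 0 ≤ w * (1 + 1 / a) * (lam ^ 2 * (w ^ 2 / a) * E₀) := by positivity
  linarith

theorem exists_abs_le_of_support_subset_Icc {W : ℝ → ℝ} {p q : ℝ} (hW : Continuous W)
    (hsupp : Function.support W ⊆ Set.Icc p q) : ∃ w, ∀ x, |W x| ≤ w :=
  hW.bounded_above_of_compact_support (HasCompactSupport.intro isCompact_Icc fun _ hx =>
    Function.notMem_support.1 fun h => hx (hsupp h))

/-- Energy bound for the difference of the perturbed and the unperturbed solution. -/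
theorem perturbation_energy_le {a w N ξ lam : ℝ} {W V u u' v v' : ℝ → ℝ} (ha : 0 < a)
    (hWsupp : Function.support W ⊆ Set.Icc 0 1) (hw : ∀ x, |W x| ≤ w) (hN : 0 < N)
    (hV : ContinuousOn V (Set.Ici 0)) (hVN : ∀ x, N ≤ x → V x = 0) (haξ : a ≤ ξ)
    (hlam : |lam| ≤ 1)
    (hu : ∀ x ∈ Set.Ici (0 : ℝ), HasDerivWithinAt u (u' x) (Set.Ici 0) x)
    (hu' : ∀ x ∈ Set.Ici (0 : ℝ), HasDerivWithinAt u' ((V x - ξ) * u x) (Set.Ici 0) x)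
    (hv : ∀ x ∈ Set.Ici (0 : ℝ), HasDerivWithinAt v (v' x) (Set.Ici 0) x)
    (hv' : ∀ x ∈ Set.Ici (0 : ℝ),
      HasDerivWithinAt v' ((V x + lam * W (x - N) - ξ) * v x) (Set.Ici 0) x)
    (h0 : v 0 = u 0) (h0' : v' 0 = u' 0) {x : ℝ} (hx : 0 ≤ x) :
    ξ * (v x - u x) ^ 2 + (v' x - u' x) ^ 2 ≤
      lam ^ 2 * (w ^ 2 / a) * Real.exp (1 + w * (1 + 1 / a)) * (ξ * u x ^ 2 + u' x ^ 2) := by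
  have hξ : 0 < ξ := ha.trans_le haξ
  have hw0 : 0 ≤ w := (abs_nonneg _).trans (hw 0)
  have cont {f f' : ℝ → ℝ} (h : ∀ x ∈ Set.Ici (0 : ℝ), HasDerivWithinAt f (f' x) (Set.Ici 0) x) :
      ContinuousOn f (Set.Ici 0) := fun x hx => (h x hx).continuousWithinAt
  have cu := cont hu
  have cu' := cont hu'
  have cv := cont hv
  have cv' := cont hv'
  have up {f : ℝ → ℝ} {f' x : ℝ} (h : HasDerivWithinAt f f' (Set.Ici 0) x) (hx : 0 < x) :
      HasDerivAt f f' x := h.hasDerivAt (Ici_mem_nhds hx)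
  set Eu : ℝ → ℝ := fun t => ξ * u t ^ 2 + u' t ^ 2 with hEu
  set Ed : ℝ → ℝ := fun t => ξ * (v t - u t) ^ 2 + (v' t - u' t) ^ 2 with hEd
  have cEu : ContinuousOn Eu (Set.Ici 0) := by fun_prop
  have cEd : ContinuousOn Ed (Set.Ici 0) := by fun_prop
  have sub {p q : ℝ} (hp : 0 ≤ p) : Set.Icc p q ⊆ Set.Ici 0 := fun t ht => hp.trans ht.1
  have dEu {t : ℝ} (ht : 0 < t) : HasDerivAt Eu (2 * u' t * (V t * u t)) t := by
    convert hasDerivAt_energy_s16 (ξ := ξ) (up (hu t ht.le) ht) (up (hu' t ht.le) ht) using 1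
    ring
  have dEd {t : ℝ} (ht : 0 < t) : HasDerivAt Ed (2 * (v' t - u' t) *
      (V t * (v t - u t) + lam * W (t - N) * v t)) t := by
    convert hasDerivAt_energy_s16 (ξ := ξ) (y := fun t => v t - u t) (y' := fun t => v' t - u' t)
      ((up (hv t ht.le) ht).sub (up (hu t ht.le) ht))
      ((up (hv' t ht.le) ht).sub (up (hu' t ht.le) ht)) using 1
    ring
  have W0 {t : ℝ} (ht : t ∉ Set.Icc (0 : ℝ) 1) : W t = 0 :=
    Function.notMem_support.1 fun h => ht (hWsupp h)
  have Ed_before {t : ℝ} (ht : 0 ≤ t) (htN : t ≤ N) : Ed t ≤ 0 := by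
    obtain ⟨M, hM⟩ := isCompact_Icc.exists_bound_of_continuousOn (hV.mono (sub (q := N) le_rfl))
    have hM0 : 0 ≤ M := (norm_nonneg _).trans (hM 0 ⟨le_rfl, hN.le⟩)
    have h := add_le_mul_exp_of_hasDerivAt_le (K := M * (1 + 1 / a)) (B := 0) ht
      (cEd.mono (sub le_rfl)) (fun s hs => dEd hs.1) fun s hs => by
        rw [W0 fun h => by linarith [h.1, hs.2]]
        have hMs : |V s| ≤ M := hM s ⟨hs.1.le, hs.2.le.trans htN⟩
        simp only [hEd]
        generalize v s - u s = d
        generalize v' s - u' s = d'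
        have h1 : 0 ≤ d' ^ 2 / a := by positivity
        have h2 : 0 ≤ ξ * d ^ 2 := by positivity
        have h3 : d ^ 2 ≤ ξ * d ^ 2 / a := by
          rw [le_div_iff₀ ha]; nlinarith [sq_nonneg d]
        calc 2 * d' * (V s * d + lam * 0 * v s) ≤ |2 * d' * (V s * d + lam * 0 * v s)| :=
              le_abs_self _
          _ = |V s| * (2 * |d'| * |d|) := by
              simp only [mul_zero, zero_mul, add_zero, abs_mul, abs_two]; ring
          _ ≤ M * (|d'| ^ 2 + |d| ^ 2) := by gcongr; exact two_mul_le_add_sq _ _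
          _ = M * (d' ^ 2 + d ^ 2) := by simp only [sq_abs]
          _ ≤ M * (d' ^ 2 + ξ * d ^ 2 / a + ξ * d ^ 2 + d' ^ 2 / a) :=
              mul_le_mul_of_nonneg_left (by linarith) hM0
          _ = _ := by ring
    have hE0 : Ed 0 = 0 := by simp [hEd, h0, h0']
    simpa [hE0] using h
  have Eu_nonneg (t : ℝ) : 0 ≤ Eu t := by simp only [hEu]; positivity
  rcases le_total x N with hxN | hNx
  · refine (Ed_before hx hxN).trans ?_
    have := Eu_nonneg x
    positivity
  have Eu_const {t : ℝ} (ht : N ≤ t) : Eu t = Eu N := by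
    have hder : ∀ s ∈ Set.Ioo N t, HasDerivAt Eu 0 s := fun s hs => by
      simpa [hVN s hs.1.le] using dEu (hN.trans hs.1)
    have h1 := add_le_mul_exp_of_hasDerivAt_le (K := 0) (B := 0) ht (cEu.mono (sub hN.le)) hder
      (by simp)
    have h2 := add_le_mul_exp_of_hasDerivAt_le (K := 0) (B := 0) ht (cEu.mono (sub hN.le)).neg
      (fun s hs => (hder s hs).neg) (by simp)
    simp at h1 h2
    exact le_antisymm h1 h2
  set K := 1 + w * (1 + 1 / a) with hK
  have hK0 : 0 ≤ K := by positivity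
  set B := lam ^ 2 * (w ^ 2 / a) * Eu N with hB
  have hB0 : 0 ≤ B := by have := Eu_nonneg N; positivity
  have Ed_bump {t : ℝ} (ht : N ≤ t) (htN : t ≤ N + 1) : Ed t ≤ B * Real.exp K := by
    have h := add_le_mul_exp_of_hasDerivAt_le (K := K) (B := B) ht
      (cEd.mono (sub hN.le)) (fun s hs => dEd (hN.trans hs.1)) fun s hs => by
        have hus : ξ * u s ^ 2 ≤ Eu N := by
          rw [← Eu_const hs.1.le]
          exact le_add_of_nonneg_right (sq_nonneg _)
        have := perturbation_energy_growth (d := v s - u s) (d' := v' s - u' s) ha haξ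
          (hw (s - N)) hlam hus
        rw [add_sub_cancel] at this
        rwa [hVN s hs.1.le, zero_mul, zero_add]
    calc Ed t ≤ Ed t + B := by linarith
      _ ≤ _ := h
      _ ≤ (0 + B) * Real.exp (K * 1) := by
          gcongr
          · exact Ed_before hN.le le_rfl
          · linarith
      _ = B * Real.exp K := by simp
  have hEdx : Ed x ≤ B * Real.exp K := by
    rcases le_total x (N + 1) with h | h
    · exact Ed_bump hNx h
    · refine le_trans ?_ (Ed_bump (by linarith) le_rfl)
      simpa using add_le_mul_exp_of_hasDerivAt_le (K := 0) (B := 0) h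
        (cEd.mono (sub (by linarith))) (fun s hs => dEd (by linarith [hs.1])) fun s hs => by
          rw [hVN s (by linarith [hs.1]), W0 fun h => by linarith [h.2, hs.1]]
          simp
  calc Ed x ≤ B * Real.exp K := hEdx
    _ = lam ^ 2 * (w ^ 2 / a) * Real.exp K * Eu x := by rw [Eu_const hNx, hB]; ring

/-- Lemma 2.8 for the variation-of-parameters coefficients
`(A₁, A₂)ᵀ = T⁰ₓ(ξ)⁻¹·(u, u')ᵀ`: adding a sparse bump changes them by at most
`C·|λ|·‖(u(x),u'(x))‖` in Euclidean norm. -/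
theorem sparse_perturbation_coefficients_bound (a b : ℝ) (ha : 0 < a) (hab : a ≤ b)
    (W : ℝ → ℝ) (hWsmooth : ContDiff ℝ (⊤ : ℕ∞) W) (hWnonneg : ∀ x, 0 ≤ W x)
    (hWsupp : Function.support W ⊆ Set.Icc 0 1) :
    ∃ C : ℝ, 0 < C ∧ ∀ N : ℝ, 0 < N →
      ∀ V : ℝ → ℝ, ContinuousOn V (Set.Ici 0) → (∀ x, N ≤ x → V x = 0) →
      ∀ ξ ∈ Set.Icc a b, ∀ lam : ℝ, |lam| ≤ 1 →
      ∀ u u' v v' : ℝ → ℝ,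
        (∀ x ∈ Set.Ici (0 : ℝ), HasDerivWithinAt u (u' x) (Set.Ici 0) x) →
        (∀ x ∈ Set.Ici (0 : ℝ),
          HasDerivWithinAt u' ((V x - ξ) * u x) (Set.Ici 0) x) →
        (∀ x ∈ Set.Ici (0 : ℝ), HasDerivWithinAt v (v' x) (Set.Ici 0) x) →
        (∀ x ∈ Set.Ici (0 : ℝ),
          HasDerivWithinAt v' ((V x + lam * W (x - N) - ξ) * v x) (Set.Ici 0) x) →
        u 0 = 1 → v 0 = 1 → u' 0 = 0 → v' 0 = 0 →
        ∀ x : ℝ, 0 ≤ x →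
          Real.sqrt
              (((freeTransfer ξ x)⁻¹.mulVec ![v x, v' x] 0 -
                  (freeTransfer ξ x)⁻¹.mulVec ![u x, u' x] 0) ^ 2 +
                ((freeTransfer ξ x)⁻¹.mulVec ![v x, v' x] 1 -
                  (freeTransfer ξ x)⁻¹.mulVec ![u x, u' x] 1) ^ 2) ≤
            C * |lam| * Real.sqrt ((u x) ^ 2 + (u' x) ^ 2) := by
  obtain ⟨w, hw⟩ := exists_abs_le_of_support_subset_Icc hWsmooth.continuous hWsupp
  have hw0 : 0 ≤ w := (abs_nonneg _).trans (hw 0)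
  have hb : 0 < b := ha.trans_le hab
  set Q := (1 + 1 / a) * ((w ^ 2 / a + 1) * Real.exp (1 + w * (1 + 1 / a)) * (1 + b)) with hQ
  have hQ0 : 0 < Q := by positivity
  refine ⟨√Q, Real.sqrt_pos.2 hQ0, ?_⟩
  intro N hN V hV hVN ξ hξ lam hlam u u' v v' hu hu' hv hv' hu0 hv0 hu0' hv0' x hx
  have hξ0 : 0 < ξ := ha.trans_le hξ.1
  have hE := perturbation_energy_le ha hWsupp hw hN hV hVN hξ.1 hlam hu hu' hv hv'
    (hv0.trans hu0.symm) (hv0'.trans hu0'.symm) hx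
  rw [← freeTransfer_inv_energy hξ0 x] at hE
  rw [← Real.sqrt_sq_eq_abs, ← Real.sqrt_mul hQ0.le, ← Real.sqrt_mul (by positivity)]
  refine Real.sqrt_le_sqrt ?_
  generalize (freeTransfer ξ x)⁻¹.mulVec ![v x, v' x] 0 -
    (freeTransfer ξ x)⁻¹.mulVec ![u x, u' x] 0 = D₁ at *
  generalize (freeTransfer ξ x)⁻¹.mulVec ![v x, v' x] 1 -
    (freeTransfer ξ x)⁻¹.mulVec ![u x, u' x] 1 = D₂ at *
  have h1 : D₁ ^ 2 ≤ ξ * D₁ ^ 2 / a := by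
    rw [le_div_iff₀ ha]; nlinarith [sq_nonneg D₁, hξ.1]
  have h2 : 0 ≤ ξ * D₁ ^ 2 := by positivity
  have h3 : 0 ≤ D₂ ^ 2 / a := by positivity
  calc D₁ ^ 2 + D₂ ^ 2 ≤ ξ * D₁ ^ 2 / a + D₂ ^ 2 + ξ * D₁ ^ 2 + D₂ ^ 2 / a := by linarith
    _ = (1 + 1 / a) * (ξ * D₁ ^ 2 + D₂ ^ 2) := by ring
    _ ≤ (1 + 1 / a) * (lam ^ 2 * (w ^ 2 / a + 1) * Real.exp (1 + w * (1 + 1 / a)) *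
        ((1 + b) * (u x ^ 2 + u' x ^ 2))) := by
      gcongr
      refine hE.trans ?_
      gcongr
      · linarith
      · nlinarith [sq_nonneg (u x), sq_nonneg (u' x), hξ.2]
    _ = Q * lam ^ 2 * (u x ^ 2 + u' x ^ 2) := by rw [hQ]; ring
end

section
/- Let V(x) = Σₙ λₙ W(x − Nₙ) be a Pearson potential with W : ℝ → ℝ smooth, nonnegative, supported in [0,1], λₙ → 0, Nₙ positive with Nₙ + 1 < Nₙ₊₁ and Nₙ/Nₙ₊₁ → 0 (so that V(x) → 0 as x → ∞). Let u(ξ,·) be the Neumann solution of −∂ₓ²u + V·u = ξ·u, and for L > 0 let Z_L = {ξ > 0 : ∂ₓu(ξ,L) = 0}. Then for every continuous function f : ℝ → ℝ with compact support contained in (0,∞), the set Z_L ∩ supp f is finite for each L, and (1/L)·Σ_{ξ ∈ Z_L} f(ξ) → ∫₀^∞ f(ξ)·(2π√ξ)⁻¹ dξ as L → ∞. In other words, the density of states of the Pearson operator exists on (0,∞) and equals the free density of states ρ(ξ) = 1/(2π√ξ). -/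
open scoped Real

open Set Filter Topology MeasureTheory

theorem exists_primitive_Ici {q : ℝ → ℝ} (hq : ContinuousOn q (Ici 0)) :
    ∃ G : ℝ → ℝ, G 0 = 0 ∧ ∀ x ∈ Ici (0 : ℝ), HasDerivWithinAt G (q x) (Ici 0) x := by
  have hc : Continuous fun t : ℝ => q (max t 0) :=
    hq.comp_continuous (by fun_prop) fun x => le_max_right x 0
  refine ⟨fun x => ∫ t in (0 : ℝ)..x, q (max t 0), by simp, fun x hx => ?_⟩
  have h := (hc.integral_hasStrictDerivAt 0 x).hasDerivAt.hasDerivWithinAt (s := Ici 0)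
  rwa [max_eq_left (mem_Ici.1 hx)] at h

theorem monotoneOn_Ici_of_hasDerivWithinAt {f f' : ℝ → ℝ}
    (hf : ∀ x ∈ Ici (0 : ℝ), HasDerivWithinAt f (f' x) (Ici 0) x)
    (hf' : ∀ x ∈ Ici (0 : ℝ), 0 ≤ f' x) : MonotoneOn f (Ici 0) :=
  monotoneOn_of_hasDerivWithinAt_nonneg (convex_Ici 0) (fun x hx => (hf x hx).continuousWithinAt)
    (fun x hx => (hf x (interior_subset hx)).mono interior_subset)
    (fun x hx => hf' x (interior_subset hx))

theorem eq_of_hasDerivWithinAt_Ici_zero {f : ℝ → ℝ}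
    (hf : ∀ x ∈ Ici (0 : ℝ), HasDerivWithinAt f 0 (Ici 0) x) {x : ℝ} (hx : x ∈ Ici (0 : ℝ)) :
    f x = f 0 := by
  have h1 := monotoneOn_Ici_of_hasDerivWithinAt hf (fun _ _ => le_rfl) self_mem_Ici hx hx
  have h2 := monotoneOn_Ici_of_hasDerivWithinAt (f := fun x => - f x)
    (fun x hx => (hf x hx).neg.congr_deriv neg_zero) (fun _ _ => le_rfl) self_mem_Ici hx hx
  simp only [neg_le_neg_iff] at h2
  exact le_antisymm h2 h1

theorem pos_of_continuousOn_Ici_of_ne_zero {f : ℝ → ℝ} (hf : ContinuousOn f (Ici 0))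
    (h0 : 0 < f 0) (hne : ∀ x ∈ Ici (0 : ℝ), f x ≠ 0) {x : ℝ} (hx : x ∈ Ici (0 : ℝ)) :
    0 < f x := by
  by_contra! hneg
  obtain ⟨y, hy, hy0⟩ := isPreconnected_Ici.intermediate_value hx self_mem_Ici hf ⟨hneg, h0.le⟩
  exact hne y hy hy0

/-- A nontrivial Neumann solution of `v'' = (V - E) v` never has vanishing Cauchy data. -/
theorem neumann_sq_add_sq_pos {V v w : ℝ → ℝ} {E B c : ℝ} (hB : ∀ x, |V x| ≤ B) (hc : 0 < c)
    (hv : ∀ x ∈ Ici (0 : ℝ), HasDerivWithinAt v (w x) (Ici 0) x)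
    (hw : ∀ x ∈ Ici (0 : ℝ), HasDerivWithinAt w ((V x - E) * v x) (Ici 0) x)
    (hv0 : v 0 = 1) {x : ℝ} (hx : x ∈ Ici (0 : ℝ)) :
    0 < v x ^ 2 + (w x / c) ^ 2 := by
  set K := 1 + B + |E| with hK
  have hd : ∀ x ∈ Ici (0 : ℝ), HasDerivWithinAt
      (fun x => (v x ^ 2 + w x ^ 2) * Real.exp (K * x))
      ((2 * v x * w x + 2 * w x * ((V x - E) * v x)) * Real.exp (K * x)
        + (v x ^ 2 + w x ^ 2) * (Real.exp (K * x) * K)) (Ici 0) x := by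
    intro x hx
    have he : HasDerivWithinAt (fun x => Real.exp (K * x)) (Real.exp (K * x) * K) (Ici 0) x := by
      simpa using (((hasDerivAt_id x).const_mul K).exp).hasDerivWithinAt
    refine ((((hv x hx).pow 2).add ((hw x hx).pow 2)).mul he).congr_deriv ?_
    simp
  have hmono := monotoneOn_Ici_of_hasDerivWithinAt hd (fun x hx => by
    have hV := abs_le.1 (hB x)
    have hE1 := neg_abs_le E
    have hE2 := le_abs_self E
    have key : 0 ≤ 2 * v x * w x + 2 * w x * ((V x - E) * v x) + (v x ^ 2 + w x ^ 2) * K := by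
      have h1 : 0 ≤ K - (1 + V x - E) := by rw [hK]; linarith [hV.2]
      have h2 : 0 ≤ K + (1 + V x - E) := by rw [hK]; linarith [hV.1]
      nlinarith [mul_nonneg h1 (sq_nonneg (v x - w x)), mul_nonneg h2 (sq_nonneg (v x + w x))]
    have := mul_nonneg key (Real.exp_pos (K * x)).le
    linarith) self_mem_Ici hx hx
  have h1 : 0 < (v x ^ 2 + w x ^ 2) * Real.exp (K * x) := by
    refine lt_of_lt_of_le ?_ hmono
    simp only [hv0, mul_zero, Real.exp_zero]
    positivity
  have h2 : 0 < v x ^ 2 + w x ^ 2 := (pos_iff_pos_of_mul_pos h1).2 (Real.exp_pos _)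
  by_cases h : w x = 0
  · simpa [h] using h2
  · have : w x / c ≠ 0 := div_ne_zero h hc.ne'
    positivity

/-- Existence of a Prüfer angle with weight `c` for a Neumann solution of `v'' = (V - E) v`. -/
theorem exists_prufer_angle {V v w : ℝ → ℝ} {E B c : ℝ} (hV : Continuous V)
    (hB : ∀ x, |V x| ≤ B) (hc : 0 < c)
    (hv : ∀ x ∈ Ici (0 : ℝ), HasDerivWithinAt v (w x) (Ici 0) x)
    (hw : ∀ x ∈ Ici (0 : ℝ), HasDerivWithinAt w ((V x - E) * v x) (Ici 0) x)
    (hv0 : v 0 = 1) (hw0 : w 0 = 0) :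
    ∃ ψ : ℝ → ℝ, ψ 0 = 0 ∧
      (∀ x ∈ Ici (0 : ℝ), HasDerivWithinAt ψ
        (c * Real.sin (ψ x) ^ 2 + (E - V x) / c * Real.cos (ψ x) ^ 2) (Ici 0) x) ∧
      ∀ x ∈ Ici (0 : ℝ), ∃ ρ > 0, v x = ρ * Real.cos (ψ x) ∧ w x = -(c * ρ * Real.sin (ψ x)) := by
  have hpos := fun x (hx : x ∈ Ici (0 : ℝ)) => neumann_sq_add_sq_pos hB hc hv hw hv0 hx
  have hvc : ContinuousOn v (Ici 0) := fun x hx => (hv x hx).continuousWithinAt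
  have hwc : ContinuousOn w (Ici 0) := fun x hx => (hw x hx).continuousWithinAt
  obtain ⟨ψ, hψ0, hψ⟩ := exists_primitive_Ici
    (q := fun x => ((E - V x) / c * v x ^ 2 + c * (w x / c) ^ 2) / (v x ^ 2 + (w x / c) ^ 2))
    (ContinuousOn.div (by fun_prop) (by fun_prop) fun x hx => (hpos x hx).ne')
  set r : ℝ → ℝ := fun x => v x ^ 2 + (w x / c) ^ 2 with hr
  set q : ℝ → ℝ := fun x => ((E - V x) / c * v x ^ 2 + c * (w x / c) ^ 2) / r x with hq
  set P : ℝ → ℝ := fun x => v x * Real.cos (ψ x) - w x / c * Real.sin (ψ x) with hP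
  set Q : ℝ → ℝ := fun x => v x * Real.sin (ψ x) + w x / c * Real.cos (ψ x) with hQ
  have hψc : ContinuousOn ψ (Ici 0) := fun x hx => (hψ x hx).continuousWithinAt
  have hQd : ∀ x ∈ Ici (0 : ℝ), HasDerivWithinAt Q
      (w x * Real.sin (ψ x) + (V x - E) * v x / c * Real.cos (ψ x) + q x * P x) (Ici 0) x := by
    intro x hx
    have := ((hv x hx).mul (hψ x hx).sin).add (((hw x hx).div_const c).mul (hψ x hx).cos)
    refine this.congr_deriv ?_
    simp only [hP, hq, hr]
    ring
  have hrd : ∀ x ∈ Ici (0 : ℝ), HasDerivWithinAt r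
      (2 * v x * w x + 2 * (w x / c) * ((V x - E) * v x / c)) (Ici 0) x := by
    intro x hx
    have := ((hv x hx).pow 2).add (((hw x hx).div_const c).pow 2)
    refine this.congr_deriv ?_
    simp
  have hQ0 : ∀ x ∈ Ici (0 : ℝ), Q x = 0 := by
    intro x hx
    have hd : ∀ x ∈ Ici (0 : ℝ), HasDerivWithinAt (fun x => Q x ^ 2 / r x) 0 (Ici 0) x := by
      intro x hx
      refine (((hQd x hx).pow 2).div (hrd x hx) (hpos x hx).ne').congr_deriv ?_
      have hqr : q x * r x = (E - V x) / c * v x ^ 2 + c * (w x / c) ^ 2 :=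
        div_mul_cancel₀ _ (hpos x hx).ne'
      have key : (w x * Real.sin (ψ x) + (V x - E) * v x / c * Real.cos (ψ x) + q x * P x) * r x
          = Q x * (v x * w x + (w x / c) * ((V x - E) * v x / c)) := by
        have : (w x * Real.sin (ψ x) + (V x - E) * v x / c * Real.cos (ψ x) + q x * P x) * r x
          = (w x * Real.sin (ψ x) + (V x - E) * v x / c * Real.cos (ψ x)) * r x
            + (q x * r x) * P x := by ring
        rw [this, hqr]
        simp only [hP, hQ, hr]
        field_simp
        ring
      rw [div_eq_zero_iff]
      left
      simp only [Nat.cast_ofNat, Nat.add_one_sub_one, pow_one, Pi.pow_apply]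
      linear_combination (2 * Q x) * key
    have h := eq_of_hasDerivWithinAt_Ici_zero hd hx
    have hQz : Q 0 = 0 := by simp [hQ, hψ0, hw0]
    rw [hQz] at h
    simpa [(hpos x hx).ne', hr] using h
  have hPQ : ∀ x, P x ^ 2 + Q x ^ 2 = r x := fun x => by
    simp only [hP, hQ, hr]
    linear_combination (v x ^ 2 + (w x / c) ^ 2) * Real.sin_sq_add_cos_sq (ψ x)
  have hPpos : ∀ x ∈ Ici (0 : ℝ), 0 < P x := fun x hx => by
    refine pos_of_continuousOn_Ici_of_ne_zero (f := P) ?_ ?_ (fun y hy hy0 => ?_) hx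
    · exact (hvc.mul (Real.continuous_cos.comp_continuousOn hψc)).sub
        ((hwc.div_const c).mul (Real.continuous_sin.comp_continuousOn hψc))
    · simp [hP, hψ0, hv0]
    · have := hPQ y
      rw [hy0, hQ0 y hy] at this
      have := hpos y hy
      simp only [hr] at *
      linarith
  have hvP : ∀ x ∈ Ici (0 : ℝ), v x = P x * Real.cos (ψ x) := fun x hx => by
    have h := hQ0 x hx
    simp only [hQ] at h
    simp only [hP]
    linear_combination (-v x) * Real.sin_sq_add_cos_sq (ψ x) + Real.sin (ψ x) * h
  have hwP : ∀ x ∈ Ici (0 : ℝ), w x / c = -(P x * Real.sin (ψ x)) := fun x hx => by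
    have h := hQ0 x hx
    simp only [hQ] at h
    simp only [hP]
    linear_combination (-(w x / c)) * Real.sin_sq_add_cos_sq (ψ x) + Real.cos (ψ x) * h
  refine ⟨ψ, hψ0, fun x hx => (hψ x hx).congr_deriv ?_, fun x hx => ⟨P x, hPpos x hx, hvP x hx, ?_⟩⟩
  · have hP2 := hPpos x hx
    simp only [hvP x hx, hwP x hx]
    have h1 := Real.sin_sq_add_cos_sq (ψ x)
    have h2 : (P x * Real.cos (ψ x)) ^ 2 + (-(P x * Real.sin (ψ x))) ^ 2 = P x ^ 2 := by
      linear_combination P x ^ 2 * h1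
    rw [h2]
    field_simp
    ring
  · have := hwP x hx
    rw [div_eq_iff hc.ne'] at this
    rw [this]; ring

/-- Prüfer angles of the same solution with different weights stay within `π / 2`. -/
theorem abs_prufer_sub_prufer_lt {v w ψ θ : ℝ → ℝ} {c : ℝ} (hc : 0 < c)
    (hψc : ContinuousOn ψ (Ici 0)) (hθc : ContinuousOn θ (Ici 0)) (hψ0 : ψ 0 = 0) (hθ0 : θ 0 = 0)
    (hψ : ∀ x ∈ Ici (0 : ℝ), ∃ ρ > 0, v x = ρ * Real.cos (ψ x) ∧ w x = -(1 * ρ * Real.sin (ψ x)))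
    (hθ : ∀ x ∈ Ici (0 : ℝ), ∃ ρ > 0, v x = ρ * Real.cos (θ x) ∧ w x = -(c * ρ * Real.sin (θ x)))
    {x : ℝ} (hx : x ∈ Ici (0 : ℝ)) : |ψ x - θ x| < π / 2 := by
  have hcos : ∀ x ∈ Ici (0 : ℝ), 0 < Real.cos (ψ x - θ x) := by
    intro x hx
    obtain ⟨ρ, hρ, h1, h2⟩ := hψ x hx
    obtain ⟨σ, hσ, h3, h4⟩ := hθ x hx
    have h5 : ρ * Real.cos (ψ x - θ x) = σ * (Real.cos (θ x) ^ 2 + c * Real.sin (θ x) ^ 2) := by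
      rw [Real.cos_sub]
      linear_combination Real.cos (θ x) * (h3 - h1) + Real.sin (θ x) * (h2 - h4)
    have h6 : 0 < Real.cos (θ x) ^ 2 + c * Real.sin (θ x) ^ 2 := by
      by_cases h : Real.sin (θ x) = 0
      · have := Real.sin_sq_add_cos_sq (θ x)
        simp only [h] at this ⊢
        nlinarith
      · positivity
    have h7 : 0 < ρ * Real.cos (ψ x - θ x) := h5 ▸ mul_pos hσ h6
    exact (pos_iff_pos_of_mul_pos h7).1 hρ
  have h1 : 0 < π / 2 - (ψ x - θ x) := by
    refine pos_of_continuousOn_Ici_of_ne_zero (f := fun x => π / 2 - (ψ x - θ x)) (by fun_prop)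
      (by simp [hψ0, hθ0, Real.pi_pos]) (fun y hy h => ?_) hx
    have := hcos y hy
    rw [← sub_eq_zero.1 h, Real.cos_pi_div_two] at this
    exact lt_irrefl _ this
  have h2 : 0 < π / 2 + (ψ x - θ x) := by
    refine pos_of_continuousOn_Ici_of_ne_zero (f := fun x => π / 2 + (ψ x - θ x)) (by fun_prop)
      (by simp [hψ0, hθ0, Real.pi_pos]) (fun y hy h => ?_) hx
    have := hcos y hy
    rw [← Real.cos_neg, ← eq_neg_of_add_eq_zero_left h, Real.cos_pi_div_two] at this
    exact lt_irrefl _ this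
  exact abs_lt.2 ⟨by linarith, by linarith⟩

theorem sin_sq_sub_sin_sq_eq (a b : ℝ) :
    Real.sin a ^ 2 - Real.sin b ^ 2 = Real.sin (a + b) * Real.sin (a - b) := by
  rw [Real.sin_add, Real.sin_sub]
  linear_combination (Real.sin b ^ 2 ) * Real.sin_sq_add_cos_sq a
    - Real.sin a ^ 2 * Real.sin_sq_add_cos_sq b

theorem sinc_mul_self (x : ℝ) : Real.sinc x * x = Real.sin x := by
  by_cases h : x = 0
  · simp [h]
  · rw [Real.sinc_of_ne_zero h, div_mul_cancel₀ _ h]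

/-- Strict monotonicity of the Prüfer angle in the energy. -/
theorem prufer_angle_lt {V a b : ℝ → ℝ} {ξ η : ℝ} (hV : Continuous V) (hξη : ξ < η)
    (ha0 : a 0 = 0) (hb0 : b 0 = 0)
    (ha : ∀ x ∈ Ici (0 : ℝ), HasDerivWithinAt a
        (1 * Real.sin (a x) ^ 2 + (ξ - V x) / 1 * Real.cos (a x) ^ 2) (Ici 0) x)
    (hb : ∀ x ∈ Ici (0 : ℝ), HasDerivWithinAt b
        (1 * Real.sin (b x) ^ 2 + (η - V x) / 1 * Real.cos (b x) ^ 2) (Ici 0) x)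
    {L : ℝ} (hL : 0 < L) : a L < b L := by
  have hac : ContinuousOn a (Ici 0) := fun x hx => (ha x hx).continuousWithinAt
  have hbc : ContinuousOn b (Ici 0) := fun x hx => (hb x hx).continuousWithinAt
  obtain ⟨G, hG0, hG⟩ := exists_primitive_Ici
    (q := fun x => (1 + V x - η) * Real.sin (b x + a x) * Real.sinc (b x - a x))
    ((ContinuousOn.mul (by fun_prop)
      (Real.continuous_sin.comp_continuousOn (hbc.add hac))).mul
      (Real.continuous_sinc.comp_continuousOn (hbc.sub hac)))
  have hM : ∀ x ∈ Ici (0 : ℝ), HasDerivWithinAt (fun x => (b x - a x) * Real.exp (-G x))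
      ((η - ξ) * Real.cos (a x) ^ 2 * Real.exp (-G x)) (Ici 0) x := by
    intro x hx
    refine (((hb x hx).sub (ha x hx)).mul (hG x hx).neg.exp).congr_deriv ?_
    have h1 := sin_sq_sub_sin_sq_eq (b x) (a x)
    rw [← sinc_mul_self (b x - a x)] at h1
    have h2 := Real.sin_sq_add_cos_sq (b x)
    have h3 := Real.sin_sq_add_cos_sq (a x)
    simp only [Pi.sub_apply]
    linear_combination Real.exp (-G x) * ((1 + V x - η) * h1 + (η - V x) * h2 - (η - V x) * h3)
  have hmono := monotoneOn_Ici_of_hasDerivWithinAt hM fun x hx =>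
    mul_nonneg (mul_nonneg (sub_pos.2 hξη).le (sq_nonneg _)) (Real.exp_pos _).le
  by_contra! hle
  have hM0 : ∀ x ∈ Icc 0 L, (b x - a x) * Real.exp (-G x) = 0 := by
    intro x hx
    have h1 := hmono self_mem_Ici hx.1 hx.1
    have h2 := hmono hx.1 hL.le hx.2
    simp only [ha0, hb0, sub_self, zero_mul] at h1
    have h3 : (b L - a L) * Real.exp (-G L) ≤ 0 :=
      mul_nonpos_of_nonpos_of_nonneg (by linarith) (Real.exp_pos _).le
    exact le_antisymm (h2.trans h3) h1
  have hd1 := (hM 0 self_mem_Ici).mono (Icc_subset_Ici_self : Icc 0 L ⊆ Ici 0)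
  have hd2 : HasDerivWithinAt (fun x => (b x - a x) * Real.exp (-G x)) 0 (Icc 0 L) 0 :=
    (hasDerivWithinAt_const 0 (Icc 0 L) (0 : ℝ)).congr hM0 (hM0 0 (left_mem_Icc.2 hL.le))
  have := (uniqueDiffOn_Icc hL 0 (left_mem_Icc.2 hL.le)).eq_deriv _ hd1 hd2
  simp [ha0, hG0, sub_eq_zero, hξη.ne'] at this

/-- Continuity of the Prüfer angle in the energy. -/
theorem continuous_prufer_angle {V : ℝ → ℝ} {φ : ℝ → ℝ → ℝ} {B : ℝ} (hB : ∀ x, |V x| ≤ B)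
    (h0 : ∀ ξ, φ ξ 0 = 0)
    (hφ : ∀ ξ, ∀ x ∈ Ici (0 : ℝ), HasDerivWithinAt (φ ξ)
        (1 * Real.sin (φ ξ x) ^ 2 + (ξ - V x) / 1 * Real.cos (φ ξ x) ^ 2) (Ici 0) x)
    {L : ℝ} (hL : 0 < L) : Continuous fun ξ => φ ξ L := by
  have hB0 : 0 ≤ B := (abs_nonneg _).trans (hB 0)
  refine continuous_iff_continuousAt.2 fun ξ => ?_
  let K : NNReal := ⟨1 + B + |ξ|, by positivity⟩
  have hK0 : (K : ℝ) ≠ 0 := by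
    change 1 + B + |ξ| ≠ 0
    positivity
  have hlip : ∀ t, LipschitzWith K
      fun y => 1 * Real.sin y ^ 2 + (ξ - V t) / 1 * Real.cos y ^ 2 := by
    intro t
    refine LipschitzWith.of_dist_le_mul fun y z => ?_
    rw [Real.dist_eq, Real.dist_eq]
    have h : 1 * Real.sin y ^ 2 + (ξ - V t) / 1 * Real.cos y ^ 2
        - (1 * Real.sin z ^ 2 + (ξ - V t) / 1 * Real.cos z ^ 2)
        = (1 + V t - ξ) * (Real.sin (y + z) * Real.sin (y - z)) := by
      have h1 := sin_sq_sub_sin_sq_eq y z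
      have h2 := Real.sin_sq_add_cos_sq y
      have h3 := Real.sin_sq_add_cos_sq z
      linear_combination (1 + V t - ξ) * h1 + (ξ - V t) * h2 - (ξ - V t) * h3
    rw [h, abs_mul, abs_mul]
    have h1 : |1 + V t - ξ| ≤ K := by
      change _ ≤ 1 + B + |ξ|
      have h2 := abs_le.1 (hB t)
      have h3 := neg_abs_le ξ
      have h4 := le_abs_self ξ
      exact abs_le.2 ⟨by linarith [h2.1], by linarith [h2.2]⟩
    have h2 : |Real.sin (y + z)| * |Real.sin (y - z)| ≤ 1 * |y - z| :=
      mul_le_mul (Real.abs_sin_le_one _) Real.abs_sin_le_abs (abs_nonneg _) zero_le_one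
    rw [one_mul] at h2
    exact mul_le_mul h1 h2 (by positivity) (by positivity)
  have hc : ∀ ξ, ContinuousOn (φ ξ) (Icc 0 L) := fun ξ x hx =>
    ((hφ ξ x hx.1).mono Icc_subset_Ici_self).continuousWithinAt
  have hd : ∀ ξ, ∀ x ∈ Ico 0 L, HasDerivWithinAt (φ ξ)
      (1 * Real.sin (φ ξ x) ^ 2 + (ξ - V x) / 1 * Real.cos (φ ξ x) ^ 2) (Ici x) x :=
    fun ξ x hx => (hφ ξ x hx.1).mono (Ici_subset_Ici.2 hx.1)
  have hbound : ∀ η, dist (φ η L) (φ ξ L) ≤ gronwallBound 0 K (|η - ξ| + 0) (L - 0) := by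
    intro η
    refine dist_le_of_approx_trajectories_ODE hlip (hc η) (hd η) (fun t ht => ?_) (hc ξ) (hd ξ)
      (fun t ht => by rw [dist_self]) (by simp [h0]) L (right_mem_Icc.2 hL.le)
    rw [Real.dist_eq]
    have h : 1 * Real.sin (φ η t) ^ 2 + (η - V t) / 1 * Real.cos (φ η t) ^ 2
        - (1 * Real.sin (φ η t) ^ 2 + (ξ - V t) / 1 * Real.cos (φ η t) ^ 2)
        = (η - ξ) * Real.cos (φ η t) ^ 2 := by ring
    rw [h, abs_mul, abs_of_nonneg (sq_nonneg (Real.cos _))]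
    exact mul_le_of_le_one_right (abs_nonneg _) (Real.cos_sq_le_one _)
  rw [ContinuousAt, tendsto_iff_dist_tendsto_zero]
  refine squeeze_zero (fun _ => dist_nonneg) hbound ?_
  simp only [gronwallBound_of_K_ne_0 hK0]
  have : ContinuousAt (fun η => 0 * Real.exp (K * (L - 0)) +
      (|η - ξ| + 0) / K * (Real.exp (K * (L - 0)) - 1)) ξ := by fun_prop
  simpa [ContinuousAt] using this

theorem tendsto_div_of_tendsto_deriv_zero {g g' : ℝ → ℝ}
    (hg : ∀ x ∈ Ici (0 : ℝ), HasDerivWithinAt g (g' x) (Ici 0) x)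
    (hg' : Tendsto g' atTop (𝓝 0)) : Tendsto (fun L => g L / L) atTop (𝓝 0) := by
  refine Metric.tendsto_atTop.2 fun ε hε => ?_
  obtain ⟨X, hX⟩ := Metric.tendsto_atTop.1 hg' (ε / 2) (by positivity)
  set Y := max X 0
  have hY0 : 0 ≤ Y := le_max_right _ _
  refine ⟨Y + 1 + 2 * |g Y| / ε, fun L hL => ?_⟩
  have hq : 0 ≤ 2 * |g Y| / ε := by positivity
  have hL0 : 0 < L := by linarith
  have hmv := Convex.norm_image_sub_le_of_norm_hasDerivWithin_le (s := Ici Y) (C := ε / 2)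
    (x := Y) (y := L)
    (fun x hx => (hg x (hY0.trans hx)).mono (Ici_subset_Ici.2 hY0))
    (fun x hx => by
      have := hX x ((le_max_left X 0).trans hx)
      rw [dist_zero_right] at this
      exact this.le) (convex_Ici Y) self_mem_Ici (by simp only [mem_Ici]; linarith)
  rw [Real.norm_eq_abs, Real.norm_eq_abs, abs_of_nonneg (by linarith : 0 ≤ L - Y)] at hmv
  rw [dist_zero_right, Real.norm_eq_abs, abs_div, abs_of_pos hL0, div_lt_iff₀ hL0]
  have h1 : |g L| ≤ |g L - g Y| + |g Y| := by
    have := abs_add_le (g L - g Y) (g Y)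
    simpa using this
  have h2 : 2 * |g Y| < ε * L := by
    have : 2 * |g Y| / ε < L := by linarith
    rw [div_lt_iff₀ hε] at this
    linarith
  nlinarith

/-- The Prüfer angle of weight one is asymptotic to `√E L` if the potential vanishes at infinity. -/
theorem prufer_angle_div_tendsto {V v w ψ : ℝ → ℝ} {E B : ℝ} (hV : Continuous V)
    (hB : ∀ x, |V x| ≤ B) (hV0 : Tendsto V atTop (𝓝 0)) (hE : 0 < E)
    (hv : ∀ x ∈ Ici (0 : ℝ), HasDerivWithinAt v (w x) (Ici 0) x)
    (hw : ∀ x ∈ Ici (0 : ℝ), HasDerivWithinAt w ((V x - E) * v x) (Ici 0) x)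
    (hv0 : v 0 = 1) (hw0 : w 0 = 0) (hψc : ContinuousOn ψ (Ici 0)) (hψ0 : ψ 0 = 0)
    (hψ : ∀ x ∈ Ici (0 : ℝ), ∃ ρ > 0,
      v x = ρ * Real.cos (ψ x) ∧ w x = -(1 * ρ * Real.sin (ψ x))) :
    Tendsto (fun L => ψ L / L) atTop (𝓝 (√E)) := by
  have hc : 0 < √E := Real.sqrt_pos.2 hE
  obtain ⟨θ, hθ0, hθ, hθvw⟩ := exists_prufer_angle hV hB hc hv hw hv0 hw0
  have hθc : ContinuousOn θ (Ici 0) := fun x hx => (hθ x hx).continuousWithinAt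
  have h1 : Tendsto (fun L => (θ L - √E * L) / L) atTop (𝓝 0) := by
    refine tendsto_div_of_tendsto_deriv_zero (g := fun x => θ x - √E * x)
      (g' := fun x => -(V x / √E * Real.cos (θ x) ^ 2)) (fun x hx => ?_) ?_
    · refine ((hθ x hx).sub ((hasDerivWithinAt_id x _).const_mul (√E))).congr_deriv ?_
      have hs : E / √E = √E := Real.div_sqrt
      rw [sub_div, hs]
      linear_combination √E * Real.sin_sq_add_cos_sq (θ x)
    · refine squeeze_zero_norm (fun x => ?_) (a := fun x => ‖V x / √E‖)
        (by simpa using (hV0.div_const (√E)).norm)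
      rw [norm_neg, norm_mul]
      refine mul_le_of_le_one_right (norm_nonneg _) ?_
      rw [Real.norm_of_nonneg (sq_nonneg _)]
      exact Real.cos_sq_le_one _
  have h2 : Tendsto (fun L => (ψ L - θ L) / L) atTop (𝓝 0) := by
    refine squeeze_zero_norm' ?_ (tendsto_const_nhds.div_atTop tendsto_id (a := π / 2))
    filter_upwards [eventually_gt_atTop 0] with L hL
    rw [norm_div, Real.norm_of_nonneg hL.le]
    exact div_le_div_of_nonneg_right
      (abs_prufer_sub_prufer_lt hc hψc hθc hψ0 hθ0 hψ hθvw hL.le).le hL.le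
  have h3 := (h1.add h2).add_const (√E)
  rw [add_zero, zero_add] at h3
  refine h3.congr' ?_
  filter_upwards [eventually_gt_atTop 0] with L hL
  field_simp
  ring

/-- At each point at most one bump of a Pearson potential is active. -/
theorem pearson_tsum_eq_single {W : ℝ → ℝ} (hWsupp : Function.support W ⊆ Icc 0 1)
    (lam : ℕ → ℝ) {N : ℕ → ℝ} (hNmono : StrictMono N) (hNgap : ∀ n, N n + 1 < N (n + 1))
    {x : ℝ} {n : ℕ} (hn : W (x - N n) ≠ 0) :
    ∑' m, lam m * W (x - N m) = lam n * W (x - N n) := by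
  have key : ∀ {i j : ℕ}, i < j → W (x - N i) ≠ 0 → W (x - N j) ≠ 0 → False := by
    intro i j hij hi hj
    have h1 := (hWsupp hi).2
    have h2 := (hWsupp hj).1
    have h3 := hNgap i
    have h4 := hNmono.monotone (Nat.succ_le_of_lt hij)
    simp only [Nat.succ_eq_add_one] at h4
    linarith
  refine tsum_eq_single n fun m hm => ?_
  by_cases h : W (x - N m) = 0
  · rw [h, mul_zero]
  · exact (hm.lt_or_gt.elim (fun h' => key h' h hn) fun h' => key h' hn h).elim

theorem pearson_abs_tsum_le {W : ℝ → ℝ} (hWsupp : Function.support W ⊆ Icc 0 1)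
    {lam : ℕ → ℝ} {N : ℕ → ℝ} (hNmono : StrictMono N) (hNgap : ∀ n, N n + 1 < N (n + 1))
    {C D : ℝ} (hC : ∀ x, |W x| ≤ C) (hD : 0 ≤ D) {m : ℕ} (hlam : ∀ n ≥ m, |lam n| ≤ D)
    {x : ℝ} (hx : ∀ n < m, N n + 1 < x) : |∑' n, lam n * W (x - N n)| ≤ D * C := by
  have hC0 : 0 ≤ C := (abs_nonneg _).trans (hC 0)
  by_cases h : ∃ n, W (x - N n) ≠ 0
  · obtain ⟨n, hn⟩ := h
    rw [pearson_tsum_eq_single hWsupp lam hNmono hNgap hn, abs_mul]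
    have hmn : m ≤ n := by
      by_contra! hlt
      have h1 := hx n hlt
      have h2 := (hWsupp hn).2
      linarith
    exact mul_le_mul (hlam n hmn) (hC _) (abs_nonneg _) hD
  · push Not at h
    simp only [h, mul_zero, tsum_zero, abs_zero]
    positivity

theorem continuous_pearson {W : ℝ → ℝ} (hW : Continuous W)
    (hWsupp : Function.support W ⊆ Icc 0 1)
    (lam : ℕ → ℝ) {N : ℕ → ℝ} (hNmono : StrictMono N) (hN : Tendsto N atTop atTop) :
    Continuous fun x => ∑' n, lam n * W (x - N n) := by
  refine continuous_iff_continuousAt.2 fun x => ?_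
  obtain ⟨m, hm⟩ := (hN.eventually_gt_atTop x).exists
  have h : (fun x => ∑' n, lam n * W (x - N n)) =ᶠ[𝓝 x]
      fun x => ∑ n ∈ Finset.range m, lam n * W (x - N n) := by
    filter_upwards [Iio_mem_nhds hm] with y hy
    refine tsum_eq_sum fun n hn => ?_
    have h1 := hNmono.monotone (not_lt.1 (mt Finset.mem_range.2 hn))
    by_contra h2
    have h3 := (hWsupp (right_ne_zero_of_mul h2)).1
    have := mem_Iio.1 hy
    linarith
  exact (ContinuousAt.congr (by fun_prop) h.symm)

theorem pearson_starts_tendsto_atTop {N : ℕ → ℝ} (hNpos : ∀ n, 0 < N n)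
    (hNgap : ∀ n, N n + 1 < N (n + 1)) : Tendsto N atTop atTop := by
  refine tendsto_atTop_mono (fun n => ?_) tendsto_natCast_atTop_atTop
  induction n with
  | zero => simpa using (hNpos 0).le
  | succ k ih => push_cast; linarith [hNgap k]

theorem tendsto_pearson_zero {W : ℝ → ℝ} (hWsupp : Function.support W ⊆ Icc 0 1)
    {lam : ℕ → ℝ} (hlam : Tendsto lam atTop (𝓝 0)) {N : ℕ → ℝ} (hNmono : StrictMono N)
    (hNgap : ∀ n, N n + 1 < N (n + 1)) {C : ℝ} (hC : ∀ x, |W x| ≤ C) :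
    Tendsto (fun x => ∑' n, lam n * W (x - N n)) atTop (𝓝 0) := by
  have hC0 : 0 ≤ C := (abs_nonneg _).trans (hC 0)
  refine Metric.tendsto_atTop.2 fun ε hε => ?_
  obtain ⟨m, hm⟩ := Metric.tendsto_atTop.1 hlam (ε / (C + 1)) (by positivity)
  refine ⟨N m + 1, fun x hx => ?_⟩
  rw [dist_zero_right, Real.norm_eq_abs]
  refine lt_of_le_of_lt (pearson_abs_tsum_le (D := ε / (C + 1)) hWsupp hNmono hNgap hC
    (by positivity) (fun n hn => by simpa using (hm n hn).le)
    fun n hn => by have := hNmono hn; linarith) ?_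
  rw [div_mul_eq_mul_div, div_lt_iff₀ (by positivity)]
  nlinarith

theorem exists_Icc_of_isCompact_subset_Ioi {K : Set ℝ} (hK : IsCompact K) (hpos : K ⊆ Ioi 0) :
    ∃ a b : ℝ, 0 < a ∧ K ⊆ Icc a b := by
  rcases K.eq_empty_or_nonempty with rfl | hne
  · exact ⟨1, 1, one_pos, empty_subset _⟩
  · obtain ⟨a, ha⟩ := hK.exists_isLeast hne
    obtain ⟨b, hb⟩ := hK.exists_isGreatest hne
    exact ⟨a, b, hpos ha.1, fun x hx => ⟨ha.2 hx, hb.2 hx⟩⟩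

theorem integral_comp_floor {h : ℤ → ℝ} (hfin : h.support.Finite) :
    ∫ t : ℝ, h ⌊t⌋ = ∑' n, h n := by
  have hsum : (fun t : ℝ => h ⌊t⌋) =
      fun t => ∑ n ∈ hfin.toFinset, (Ico (n : ℝ) (n + 1)).indicator (fun _ => h n) t := by
    funext t
    rw [Finset.sum_eq_single ⌊t⌋]
    · rw [indicator_of_mem (mem_Ico.2 ⟨Int.floor_le t, Int.lt_floor_add_one t⟩)]
    · intro n _ hn
      exact indicator_of_notMem (fun hmem => hn (Int.floor_eq_iff.2 (mem_Ico.1 hmem)).symm) _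
    · intro hn
      simp only [Finite.mem_toFinset, Function.mem_support, not_not] at hn
      simp [hn]
  have hint : ∀ n : ℤ, Integrable ((Ico (n : ℝ) (n + 1)).indicator fun _ => h n) := fun n =>
    (integrable_indicator_iff measurableSet_Ico).2 (integrableOn_const (by simp))
  rw [hsum, integral_finsetSum _ fun n _ => hint n, tsum_eq_sum (s := hfin.toFinset)
    (fun n hn => by simpa using hn)]
  refine Finset.sum_congr rfl fun n _ => ?_
  rw [integral_indicator measurableSet_Ico]
  simp

theorem integral_free_density (f : ℝ → ℝ) :
    ∫ ξ in Ioi (0 : ℝ), f ξ * (1 / (2 * π * Real.sqrt ξ))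
      = π⁻¹ * ∫ k : ℝ, (Ioi (0 : ℝ)).indicator (fun k => f (k ^ 2)) k := by
  rw [integral_indicator measurableSet_Ioi, ← integral_const_mul,
    ← integral_comp_rpow_Ioi (fun ξ => f ξ * (1 / (2 * π * Real.sqrt ξ))) two_ne_zero]
  refine setIntegral_congr_fun measurableSet_Ioi fun k hk => ?_
  have hk0 : 0 < k := hk
  simp only [smul_eq_mul, Real.rpow_two, Real.sqrt_sq hk0.le, abs_two]
  rw [show (2 : ℝ) - 1 = 1 by norm_num, Real.rpow_one]
  field_simp

/-- If the zero set `Z L` is cut out by a strictly increasing angle `φ · L` hitting `π ℤ`, and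
`φ ξ L ∼ √ξ L`, then the normalized counting measures converge to the free density of states. -/
theorem tendsto_counting_of_angle {Z : ℝ → Set ℝ} {φ : ℝ → ℝ → ℝ}
    (hmono : ∀ L > 0, StrictMono fun ξ => φ ξ L) (hcont : ∀ L > 0, Continuous fun ξ => φ ξ L)
    (hZ : ∀ L > 0, ∀ ξ, ξ ∈ Z L ↔ 0 < ξ ∧ ∃ n : ℤ, n * π = φ ξ L)
    (hasym : ∀ ξ > 0, Tendsto (fun L => φ ξ L / L) atTop (𝓝 (√ξ)))
    {f : ℝ → ℝ} (hf : Continuous f) (hfc : HasCompactSupport f) (hfs : tsupport f ⊆ Ioi 0) :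
    (∀ L : ℝ, 0 < L → (Z L ∩ tsupport f).Finite) ∧
      Tendsto (fun L : ℝ => (1 / L) * ∑' ξ : Z L, f ξ) atTop
        (𝓝 (∫ ξ in Ioi (0 : ℝ), f ξ * (1 / (2 * π * Real.sqrt ξ)))) := by
  obtain ⟨a, b, ha, hab⟩ := exists_Icc_of_isCompact_subset_Ioi hfc hfs
  have hidx : ∀ L, ∃ ν : Z L → ℤ, 0 < L → ∀ ξ : Z L, ν ξ * π = φ ξ L := by
    intro L
    by_cases hL : 0 < L
    · choose ν hν using fun ξ : Z L => ((hZ L hL ξ).1 ξ.2).2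
      exact ⟨ν, fun _ => hν⟩
    · exact ⟨fun _ => 0, fun h => (hL h).elim⟩
  choose ν hν using hidx
  have hinj : ∀ L > 0, Function.Injective (ν L) := by
    intro L hL ξ η h
    refine Subtype.ext ((hmono L hL).injective ?_)
    simp only [← hν L hL, h]
  have hrange : ∀ L > 0, ∀ ξ : Z L, (ξ : ℝ) ∈ tsupport f →
      φ a L ≤ ν L ξ * π ∧ ν L ξ * π ≤ φ b L := by
    intro L hL ξ hξ
    rw [hν L hL]
    exact ⟨(hmono L hL).monotone (hab hξ).1, (hmono L hL).monotone (hab hξ).2⟩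
  have hfinite : ∀ L > 0, {ξ : Z L | (ξ : ℝ) ∈ tsupport f}.Finite := by
    intro L hL
    refine Finite.of_finite_image (f := ν L) ?_ (hinj L hL).injOn
    refine (Set.finite_Icc ⌊φ a L / π⌋ ⌊φ b L / π⌋).subset ?_
    rintro _ ⟨ξ, hξ, rfl⟩
    obtain ⟨h1, h2⟩ := hrange L hL ξ hξ
    refine ⟨?_, Int.le_floor.2 ((le_div_iff₀ Real.pi_pos).2 h2)⟩
    exact_mod_cast (Int.floor_le _).trans ((div_le_iff₀ Real.pi_pos).2 h1)
  refine ⟨fun L hL => ?_, ?_⟩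
  · refine ((hfinite L hL).image Subtype.val).subset ?_
    rintro ξ ⟨hξ, hξf⟩
    exact ⟨⟨ξ, hξ⟩, hξf, rfl⟩
  let h : ℝ → ℤ → ℝ := fun L => Function.extend (ν L) (fun ξ => f ξ) 0
  have hh : ∀ L > 0, ∀ n, h L n ≠ 0 → ∃ ξ : Z L, ν L ξ = n ∧ f ξ = h L n ∧ (ξ : ℝ) ∈ tsupport f := by
    intro L hL n hn
    by_cases hex : ∃ ξ, ν L ξ = n
    · obtain ⟨ξ, rfl⟩ := hex
      have hval : h L (ν L ξ) = f ξ := (hinj L hL).extend_apply _ _ _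
      exact ⟨ξ, rfl, hval.symm, subset_tsupport f (by rwa [hval] at hn)⟩
    · exact (hn (Function.extend_apply' _ _ _ hex)).elim
  have hsum : ∀ L > 0, (1 / L) * ∑' ξ : Z L, f ξ = π⁻¹ * ∫ k : ℝ, h L ⌊k * (L / π)⌋ := by
    intro L hL
    have hfs : (h L).support.Finite := by
      refine ((hfinite L hL).image (ν L)).subset fun n hn => ?_
      obtain ⟨ξ, h1, -, h2⟩ := hh L hL n hn
      exact ⟨ξ, h2, h1⟩
    rw [Measure.integral_comp_mul_right (fun t => h L ⌊t⌋), integral_comp_floor hfs,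
      tsum_extend_zero (hinj L hL), abs_of_pos (by positivity), smul_eq_mul]
    field_simp
  rw [integral_free_density]
  refine Tendsto.congr' (f₁ := fun L => π⁻¹ * ∫ k : ℝ, h L ⌊k * (L / π)⌋) ?_ ?_
  · filter_upwards [eventually_gt_atTop 0] with L hL using (hsum L hL).symm
  refine Tendsto.const_mul _ ?_
  obtain ⟨C, hC⟩ := hfc.exists_bound_of_continuous hf
  have hC0 : 0 ≤ C := (norm_nonneg _).trans (hC 0)
  set M := √(max a b) + 2 with hM
  have hb : 0 < max a b := lt_max_of_lt_left ha
  have hsupp : ∀ᶠ L in atTop, ∀ k, h L ⌊k * (L / π)⌋ ≠ 0 → k ∈ Icc 0 M := by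
    have e1 := (hasym a ha).eventually (lt_mem_nhds (Real.sqrt_pos.2 ha))
    have e2 := (hasym _ hb).eventually (gt_mem_nhds (lt_add_one (√(max a b))))
    filter_upwards [e1, e2, eventually_gt_atTop 0, eventually_ge_atTop π] with L h1 h2 hL hLπ k hk
    obtain ⟨ξ, hξ, -, hξf⟩ := hh L hL _ hk
    obtain ⟨h3, h4⟩ := hrange L hL ξ hξf
    rw [hξ] at h3 h4
    rw [div_pos_iff_of_pos_right hL] at h1
    rw [div_lt_iff₀ hL] at h2
    have h5 : φ b L ≤ φ (max a b) L := (hmono L hL).monotone (le_max_right _ _)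
    have hLpos : 0 < L / π := by positivity
    have h6 : k * (L / π) * π = k * L := by field_simp
    have h7 := mul_le_mul_of_nonneg_right (Int.floor_le (k * (L / π))) Real.pi_pos.le
    have h8 := mul_lt_mul_of_pos_right (Int.lt_floor_add_one (k * (L / π))) Real.pi_pos
    rw [h6] at h7 h8
    constructor
    · have : 0 < k * L := by linarith
      exact (pos_iff_pos_of_mul_pos this).2 hL |>.le
    · have : k * L < M * L := by rw [hM]; nlinarith
      exact (lt_of_mul_lt_mul_right this hL.le).le
  refine tendsto_integral_filter_of_dominated_convergence ((Icc 0 M).indicator fun _ => C)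
    ?_ ?_ ?_ ?_
  · exact Eventually.of_forall fun L =>
      ((measurable_from_top (f := h L)).comp
        (Int.measurable_floor.comp (by fun_prop))).aestronglyMeasurable
  · filter_upwards [hsupp, eventually_gt_atTop 0] with L hL hL0
    refine Eventually.of_forall fun k => ?_
    by_cases hk : h L ⌊k * (L / π)⌋ = 0
    · rw [hk, norm_zero]
      exact indicator_nonneg (fun _ _ => hC0) _
    · rw [indicator_of_mem (hL k hk)]
      obtain ⟨ξ, -, h1, -⟩ := hh L hL0 _ hk
      rw [← h1]
      exact hC _
  · exact (integrable_indicator_iff measurableSet_Icc).2 (integrableOn_const (by simp))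
  · filter_upwards [compl_mem_ae_iff.2 (measure_singleton (0 : ℝ))] with k hk0
    rcases lt_or_gt_of_ne hk0 with hk | hk
    · rw [indicator_of_notMem (by simpa using hk.le)]
      refine tendsto_const_nhds.congr' ?_
      filter_upwards [hsupp] with L hL
      by_contra hne
      exact not_le.2 hk (hL k (Ne.symm hne)).1
    rw [indicator_of_mem (mem_Ioi.2 hk)]
    refine Metric.tendsto_nhds.2 fun ε hε => ?_
    obtain ⟨δ, hδ, hfδ⟩ := Metric.continuousAt_iff (a := k).1
      (hf.comp (continuous_pow 2)).continuousAt ε hε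
    set d := min δ k / 2 with hd
    have hd0 : 0 < d := by positivity
    have hdδ : d < δ := by have := min_le_left δ k; linarith
    have hdk : d < k := by have := min_le_right δ k; linarith
    have e1 := hasym ((k - d) ^ 2) (by have := sub_pos.2 hdk; positivity)
    have e2 := hasym ((k + d) ^ 2) (by positivity)
    rw [Real.sqrt_sq (by linarith)] at e1 e2
    filter_upwards [e1.eventually (gt_mem_nhds (by linarith : k - d < k - d / 2)),
      e2.eventually (lt_mem_nhds (by linarith : k < k + d)), eventually_gt_atTop 0,
      eventually_gt_atTop (2 * π / d)] with L h1 h2 hL hLd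
    rw [div_lt_iff₀ hL] at h1
    rw [lt_div_iff₀ hL] at h2
    rw [div_lt_iff₀ hd0] at hLd
    have h6 : k * (L / π) * π = k * L := by field_simp
    have h7 := mul_le_mul_of_nonneg_right (Int.floor_le (k * (L / π))) Real.pi_pos.le
    have h8 := mul_lt_mul_of_pos_right (Int.lt_floor_add_one (k * (L / π))) Real.pi_pos
    rw [h6] at h7 h8
    obtain ⟨E, ⟨hE1, hE2⟩, hE⟩ := intermediate_value_Icc
      (by nlinarith : (k - d) ^ 2 ≤ (k + d) ^ 2) (hcont L hL).continuousOn
      (⟨by linarith, by linarith⟩ : (⌊k * (L / π)⌋ : ℝ) * π ∈ Icc (φ ((k - d) ^ 2) L) _)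
    have hE0 : 0 < E := lt_of_lt_of_le (by have := sub_pos.2 hdk; positivity) hE1
    have hEZ : E ∈ Z L := (hZ L hL E).2 ⟨hE0, _, hE.symm⟩
    have hνE : ν L ⟨E, hEZ⟩ = ⌊k * (L / π)⌋ := by
      have := (hν L hL ⟨E, hEZ⟩).trans hE
      exact_mod_cast mul_right_cancel₀ Real.pi_ne_zero this
    have hval : h L ⌊k * (L / π)⌋ = f E := by
      rw [← hνE]
      exact (hinj L hL).extend_apply _ _ _
    rw [hval]
    have hs1 : k - d ≤ √E := Real.le_sqrt_of_sq_le hE1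
    have hs2 : √E ≤ k + d := (Real.sqrt_le_left (by linarith)).2 hE2
    have := hfδ (x := √E) (by
      rw [Real.dist_eq]
      exact (abs_le.2 ⟨by linarith, by linarith⟩ : |√E - k| ≤ d).trans_lt hdδ)
    simpa [Real.sq_sqrt hE0.le] using this

/-- For a Pearson potential `V(x) = Σₙ λₙ W(x − Nₙ)` (with `W` smooth, nonnegative,
supported in `[0,1]`, `λₙ → 0`, and `Nₙ` sparse), the density of states exists on `(0,∞)`
and equals the free density of states `ρ(ξ) = 1/(2π√ξ)`: for every continuous `f` with
compact support in `(0,∞)`, `(1/L)·Σ_{ξ ∈ Z_L} f(ξ) → ∫₀^∞ f(ξ)/(2π√ξ) dξ`. -/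
theorem pearson_density_of_states (W : ℝ → ℝ) (hWsmooth : ContDiff ℝ (⊤ : ℕ∞) W)
    (hWnonneg : ∀ x, 0 ≤ W x) (hWsupp : Function.support W ⊆ Set.Icc 0 1)
    (lam : ℕ → ℝ) (hlam : Filter.Tendsto lam Filter.atTop (nhds 0))
    (N : ℕ → ℝ) (hNpos : ∀ n, 0 < N n) (hNmono : StrictMono N)
    (hNgap : ∀ n, N n + 1 < N (n + 1))
    (hNsparse : Filter.Tendsto (fun n => N n / N (n + 1)) Filter.atTop (nhds 0))
    (u ux : ℝ → ℝ → ℝ)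
    (hu : ∀ ξ : ℝ, ∀ x ∈ Set.Ici (0 : ℝ), HasDerivWithinAt (u ξ) (ux ξ x) (Set.Ici 0) x)
    (hux : ∀ ξ : ℝ, ∀ x ∈ Set.Ici (0 : ℝ),
      HasDerivWithinAt (ux ξ)
        (((∑' n, lam n * W (x - N n)) - ξ) * u ξ x) (Set.Ici 0) x)
    (hbc0 : ∀ ξ : ℝ, u ξ 0 = 1) (hbc1 : ∀ ξ : ℝ, ux ξ 0 = 0) :
    ∀ f : ℝ → ℝ, Continuous f → HasCompactSupport f → tsupport f ⊆ Set.Ioi 0 →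
      (∀ L : ℝ, 0 < L → ({ξ : ℝ | 0 < ξ ∧ ux ξ L = 0} ∩ tsupport f).Finite) ∧
      Filter.Tendsto
        (fun L : ℝ => (1 / L) * ∑' ξ : ({ξ : ℝ | 0 < ξ ∧ ux ξ L = 0} : Set ℝ), f ξ)
        Filter.atTop
        (nhds (∫ ξ in Set.Ioi (0 : ℝ), f ξ * (1 / (2 * π * Real.sqrt ξ)))) := by
  intro f hf hfc hfs
  have hW : Continuous W := hWsmooth.continuous
  have hWc : HasCompactSupport W := HasCompactSupport.of_support_subset_isCompact isCompact_Icc hWsupp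
  obtain ⟨C, hC⟩ := hWc.exists_bound_of_continuous hW
  obtain ⟨D, hD⟩ := (Metric.isBounded_range_of_tendsto lam hlam).exists_norm_le
  have hD' : ∀ n, |lam n| ≤ D := fun n => hD _ (mem_range_self n)
  have hD0 : 0 ≤ D := (abs_nonneg _).trans (hD' 0)
  have hV := continuous_pearson hW hWsupp lam hNmono (pearson_starts_tendsto_atTop hNpos hNgap)
  have hV0 := tendsto_pearson_zero hWsupp hlam hNmono hNgap hC
  have hB : ∀ x, |∑' n, lam n * W (x - N n)| ≤ D * C := fun x =>
    pearson_abs_tsum_le hWsupp hNmono hNgap hC hD0 (m := 0) (fun n _ => hD' n)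
      fun n hn => (Nat.not_lt_zero n hn).elim
  choose φ hφ0 hφ hφu using fun ξ =>
    exists_prufer_angle hV hB one_pos (hu ξ) (hux ξ) (hbc0 ξ) (hbc1 ξ)
  refine tendsto_counting_of_angle (φ := φ)
    (fun L hL ξ η hξη => prufer_angle_lt hV hξη (hφ0 ξ) (hφ0 η) (hφ ξ) (hφ η) hL)
    (fun L hL => continuous_prufer_angle hB hφ0 hφ hL) (fun L hL ξ => ?_)
    (fun ξ hξ => prufer_angle_div_tendsto hV hB hV0 hξ (hu ξ) (hux ξ) (hbc0 ξ) (hbc1 ξ)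
      (fun x hx => (hφ ξ x hx).continuousWithinAt) (hφ0 ξ) (hφu ξ)) hf hfc hfs
  obtain ⟨ρ, hρ, -, h⟩ := hφu ξ L (mem_Ici.2 hL.le)
  rw [mem_ofPred_eq, ← Real.sin_eq_zero_iff, h]
  simp [hρ.ne']
end
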